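/- arXiv:1802.08777 — 6 statements merged into one kernel-verified Lean document; each statement's English description precedes it below -/
import Mathlib

section
/- Let n ≥ 2 be an integer and let p be a real number with p > n. Set b_{n,p} = n^{−1/p} σₙ^{−1/n} ((p−1)/(p−n))^{(p−1)/p}. Then for every smooth function u : ℝⁿ → ℝ with compact support contained in the open unit ball Bⁿ, one has (sup_{x∈Bⁿ} |u(x)|)^p ≤ b_{n,p}^p ( ∫_{supp u} (2/(1−|x|²))^n dx )^{(p−n)/n} ( ∫_{Bⁿ} ((1−|x|²)/2)^p |∇u|^p (2/(1−|x|²))^n dx − ((n−1)/p)^p ∫_{Bⁿ} |u|^p (2/(1−|x|²))^n dx ), where supp u denotes the support of u. -/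
open Real MeasureTheory

/-- Volume of the Euclidean unit ball in `ℝⁿ`. -/
noncomputable def unitBallVol (n : ℕ) : ℝ := π ^ ((n : ℝ) / 2) / Real.Gamma ((n : ℝ) / 2 + 1)

/-- The sharp constant `b_{n,p}` in the Morrey–Sobolev inequality in `ℝⁿ`. -/
noncomputable def morreyConst (n : ℕ) (p : ℝ) : ℝ :=
  (n : ℝ) ^ (-(1 / p)) * unitBallVol n ^ (-(1 / (n : ℝ))) * ((p - 1) / (p - (n : ℝ))) ^ ((p - 1) / p)

/-- The volume, per unit solid angle, of the hyperbolic ball of Euclidean radius `ρ` about the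
origin in the Poincaré ball model. -/
noncomputable def hypVol (n : ℕ) (ρ : ℝ) : ℝ :=
  ∫ t in (0 : ℝ)..ρ, (2 / (1 - t ^ 2)) ^ n * t ^ (n - 1)

lemma hasDerivAt_hypVol (n : ℕ) {ρ : ℝ} (h0 : 0 ≤ ρ) (h1 : ρ < 1) :
    HasDerivAt (hypVol n) ((2 / (1 - ρ ^ 2)) ^ n * ρ ^ (n - 1)) ρ := by
  have hc : ContinuousOn (fun t : ℝ => (2 / (1 - t ^ 2)) ^ n * t ^ (n - 1)) (Set.Ioo (-1) 1) := by
    refine ContinuousOn.mul (ContinuousOn.pow (ContinuousOn.div continuousOn_const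
      (by fun_prop) ?_) _) (by fun_prop)
    intro t ht
    have := ht.1; have := ht.2
    nlinarith
  refine intervalIntegral.integral_hasDerivAt_right ?_ ?_ ?_
  · refine (hc.mono ?_).intervalIntegrable
    rw [Set.uIcc_of_le h0]
    exact fun t ht => ⟨by linarith [ht.1], by linarith [ht.2]⟩
  · exact hc.stronglyMeasurableAtFilter isOpen_Ioo ρ ⟨by linarith, h1⟩
  · exact hc.continuousAt (isOpen_Ioo.mem_nhds ⟨by linarith, h1⟩)

lemma hypVol_zero (n : ℕ) : hypVol n 0 = 0 := by simp [hypVol]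

lemma continuousOn_hypVol (n : ℕ) : ContinuousOn (hypVol n) (Set.Ico 0 1) :=
  fun _ ht => (hasDerivAt_hypVol n ht.1 ht.2).continuousAt.continuousWithinAt

lemma hypVol_strictMonoOn (n : ℕ) : StrictMonoOn (hypVol n) (Set.Ico 0 1) := by
  refine strictMonoOn_of_deriv_pos (convex_Ico 0 1) (continuousOn_hypVol n) fun t ht => ?_
  rw [interior_Ico] at ht
  rw [(hasDerivAt_hypVol n ht.1.le ht.2).deriv]
  have := ht.1
  have : 0 < 1 - t ^ 2 := by nlinarith [ht.2]
  positivity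

lemma hypVol_pos (n : ℕ) {ρ : ℝ} (h0 : 0 < ρ) (h1 : ρ < 1) : 0 < hypVol n ρ := by
  rw [← hypVol_zero n]
  exact hypVol_strictMonoOn n ⟨le_rfl, one_pos⟩ ⟨h0.le, h1⟩ h0

lemma hypVol_nonneg (n : ℕ) {ρ : ℝ} (h0 : 0 ≤ ρ) (h1 : ρ < 1) : 0 ≤ hypVol n ρ := by
  rw [← hypVol_zero n]
  exact (hypVol_strictMonoOn n).monotoneOn ⟨le_rfl, one_pos⟩ ⟨h0, h1⟩ h0

lemma hypVol_le_of_deriv {n : ℕ} {φ φ' : ℝ → ℝ} {k : ℝ} (hk : 0 ≤ φ 0)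
    (hφ : ∀ t, 0 ≤ t → t < 1 → HasDerivAt φ (φ' t) t)
    (hle : ∀ t, 0 < t → t < 1 → k * ((2 / (1 - t ^ 2)) ^ n * t ^ (n - 1)) ≤ φ' t)
    {ρ : ℝ} (h0 : 0 ≤ ρ) (h1 : ρ < 1) : k * hypVol n ρ ≤ φ ρ := by
  have hd : ∀ t, 0 ≤ t → t < 1 → HasDerivAt (fun t => φ t - k * hypVol n t)
      (φ' t - k * ((2 / (1 - t ^ 2)) ^ n * t ^ (n - 1))) t := fun t h0 h1 =>
    (hφ t h0 h1).sub ((hasDerivAt_hypVol n h0 h1).const_mul k)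
  have hm : MonotoneOn (fun t => φ t - k * hypVol n t) (Set.Ico 0 1) := by
    refine monotoneOn_of_deriv_nonneg (convex_Ico 0 1)
      (fun t ht => (hd t ht.1 ht.2).continuousAt.continuousWithinAt) ?_ ?_
    · rw [interior_Ico]
      exact fun t ht => (hd t ht.1.le ht.2).differentiableAt.differentiableWithinAt
    · rw [interior_Ico]
      intro t ht
      rw [(hd t ht.1.le ht.2).deriv]
      linarith [hle t ht.1 ht.2]
  have := hm ⟨le_rfl, one_pos⟩ ⟨h0, h1⟩ h0
  simp only [hypVol_zero] at this
  linarith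

lemma hasDerivAt_poincare_sinh {t : ℝ} (h0 : 0 ≤ t) (h1 : t < 1) :
    HasDerivAt (fun t : ℝ => 2 * t / (1 - t ^ 2))
      (2 / (1 - t ^ 2) * ((1 + t ^ 2) / (1 - t ^ 2))) t := by
  have h2 : 1 - t ^ 2 ≠ 0 := by nlinarith
  have h := ((hasDerivAt_id' t).const_mul 2).div ((hasDerivAt_pow 2 t).const_sub 1) h2
  refine h.congr_deriv ?_
  field_simp
  push_cast
  ring

lemma hasDerivAt_poincare_cosh {t : ℝ} (h0 : 0 ≤ t) (h1 : t < 1) :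
    HasDerivAt (fun t : ℝ => (1 + t ^ 2) / (1 - t ^ 2))
      (2 / (1 - t ^ 2) * (2 * t / (1 - t ^ 2))) t := by
  have h2 : 1 - t ^ 2 ≠ 0 := by nlinarith
  have h := ((hasDerivAt_pow 2 t).const_add 1).div ((hasDerivAt_pow 2 t).const_sub 1) h2
  refine h.congr_deriv ?_
  field_simp
  push_cast
  ring

lemma poincare_cosh_sq {t : ℝ} (h0 : 0 ≤ t) (h1 : t < 1) :
    ((1 + t ^ 2) / (1 - t ^ 2)) ^ 2 = 1 + (2 * t / (1 - t ^ 2)) ^ 2 := by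
  have h2 : 1 - t ^ 2 ≠ 0 := by nlinarith
  field_simp
  ring

lemma one_le_poincare_cosh {t : ℝ} (h0 : 0 ≤ t) (h1 : t < 1) :
    1 ≤ (1 + t ^ 2) / (1 - t ^ 2) := by
  rw [le_div_iff₀ (by nlinarith)]
  nlinarith

lemma poincare_sinh_nonneg {t : ℝ} (h0 : 0 ≤ t) (h1 : t < 1) : 0 ≤ 2 * t / (1 - t ^ 2) :=
  div_nonneg (by linarith) (by nlinarith)

lemma poincare_density_eq {n : ℕ} (hn : 1 ≤ n) (t : ℝ) :
    (2 / (1 - t ^ 2)) ^ n * t ^ (n - 1) = 2 / (1 - t ^ 2) * (2 * t / (1 - t ^ 2)) ^ (n - 1) := by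
  obtain ⟨m, rfl⟩ := Nat.exists_eq_add_of_le' hn
  simp only [Nat.add_sub_cancel, pow_succ, div_pow, mul_pow]
  ring

lemma sub_one_mul_hypVol_le {n : ℕ} (hn : 2 ≤ n) {ρ : ℝ} (h0 : 0 ≤ ρ) (h1 : ρ < 1) :
    ((n : ℝ) - 1) * hypVol n ρ
      ≤ (2 * ρ / (1 - ρ ^ 2)) ^ n / ((1 + ρ ^ 2) / (1 - ρ ^ 2)) := by
  refine hypVol_le_of_deriv
    (φ := fun t => (2 * t / (1 - t ^ 2)) ^ n / ((1 + t ^ 2) / (1 - t ^ 2))) ?_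
    (fun t ht0 ht1 => ((hasDerivAt_poincare_sinh ht0 ht1).pow n).div
      (hasDerivAt_poincare_cosh ht0 ht1) (by linarith [one_le_poincare_cosh ht0 ht1])) ?_ h0 h1
  · simp [show n ≠ 0 by omega]
  · intro t ht0 ht1
    rw [poincare_density_eq (by omega)]
    have hC := one_le_poincare_cosh ht0.le ht1
    have hx := poincare_sinh_nonneg ht0.le ht1
    have hCx := poincare_cosh_sq ht0.le ht1
    have hh : 0 ≤ 2 / (1 - t ^ 2) := div_nonneg (by norm_num) (by nlinarith)
    simp only [Pi.pow_apply]
    generalize 2 / (1 - t ^ 2) = H at *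
    generalize (1 + t ^ 2) / (1 - t ^ 2) = C at *
    generalize 2 * t / (1 - t ^ 2) = x at *
    obtain ⟨m, rfl⟩ := Nat.exists_eq_add_of_le' (show 1 ≤ n by omega)
    rw [le_div_iff₀ (by positivity)]
    simp only [Nat.add_sub_cancel]
    have : 0 ≤ H * x ^ m := by positivity
    have e : ↑(m + 1) * x ^ m * (H * C) * C - x ^ (m + 1) * (H * x)
       - (((m + 1 : ℕ) : ℝ) - 1) * (H * x ^ m) * C ^ 2 = H * x ^ m * (C ^ 2 - x ^ 2) := by
      push_cast; ring
    have : 0 ≤ H * x ^ m * (C ^ 2 - x ^ 2) := mul_nonneg this (by linarith)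
    linarith

lemma mul_hypVol_le {n : ℕ} (hn : 4 ≤ n) {ρ : ℝ} (h0 : 0 ≤ ρ) (h1 : ρ < 1) :
    (n : ℝ) * hypVol n ρ
      ≤ (2 * ρ / (1 - ρ ^ 2)) ^ n * ((1 + ρ ^ 2) / (1 - ρ ^ 2)) ^ (-(2 / ((n : ℝ) - 1))) := by
  refine hypVol_le_of_deriv
    (φ := fun t => (2 * t / (1 - t ^ 2)) ^ n *
      ((1 + t ^ 2) / (1 - t ^ 2)) ^ (-(2 / ((n : ℝ) - 1)))) ?_
    (fun t ht0 ht1 => ((hasDerivAt_poincare_sinh ht0 ht1).pow n).mul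
      ((hasDerivAt_poincare_cosh ht0 ht1).rpow_const
      (Or.inl (by linarith [one_le_poincare_cosh ht0 ht1])))) ?_ h0 h1
  · simp [show n ≠ 0 by omega]
  · intro t ht0 ht1
    rw [poincare_density_eq (by omega)]
    have hC := one_le_poincare_cosh ht0.le ht1
    have hx := poincare_sinh_nonneg ht0.le ht1
    have hCx := poincare_cosh_sq ht0.le ht1
    have hh : 0 ≤ 2 / (1 - t ^ 2) := div_nonneg (by norm_num) (by nlinarith)
    simp only [Pi.pow_apply]
    generalize 2 / (1 - t ^ 2) = H at *
    generalize (1 + t ^ 2) / (1 - t ^ 2) = C at *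
    generalize 2 * t / (1 - t ^ 2) = x at *
    have hnR : (4 : ℝ) ≤ n := by exact_mod_cast hn
    obtain ⟨k, hk⟩ : ∃ k : ℝ, k = 2 / ((n : ℝ) - 1) := ⟨_, rfl⟩
    have hk0 : 0 ≤ k := by rw [hk]; exact div_nonneg (by norm_num) (by linarith)
    have hkn : ((n : ℝ) + 2) * k ≤ n := by
      rw [hk, mul_div_assoc', div_le_iff₀ (by linarith)]
      nlinarith
    rw [← hk]
    have hC0 : 0 < C := by linarith
    have amgm : (n : ℝ) ≤ (n - k) * C ^ (1 - k) + k * C ^ (-1 - k) := by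
      have h := Real.geom_mean_le_arith_mean2_weighted (w₁ := (n - k) / n) (w₂ := k / n)
        (p₁ := C ^ (1 - k)) (p₂ := C ^ (-1 - k)) (div_nonneg (by nlinarith) (by linarith))
        (div_nonneg hk0 (by linarith)) (by positivity) (by positivity) (by field_simp; ring)
      rw [← Real.rpow_mul hC0.le, ← Real.rpow_mul hC0.le, ← Real.rpow_add hC0] at h
      have h1 : 1 ≤ C ^ ((1 - k) * ((n - k) / n) + (-1 - k) * (k / n)) := by
        apply Real.one_le_rpow hC
        have : (1 - k) * ((n - k) / n) + (-1 - k) * (k / n) = (n - (n + 2) * k) / n := by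
          field_simp; ring
        rw [this]
        exact div_nonneg (by linarith) (by linarith)
      have h2 := h1.trans h
      have : (n - k) / n * C ^ (1 - k) + k / n * C ^ (-1 - k)
         = ((n - k) * C ^ (1 - k) + k * C ^ (-1 - k)) / n := by ring
      rw [this, le_div_iff₀ (by linarith)] at h2
      linarith
    obtain ⟨m, rfl⟩ := Nat.exists_eq_add_of_le' (show 1 ≤ n by omega)
    simp only [Nat.add_sub_cancel]
    have e1 : C ^ (1 - k) = C ^ (-1 - k) * C ^ 2 := by
      rw [← Real.rpow_natCast, ← Real.rpow_add hC0]; congr 1; push_cast; ring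
    have e2 : C ^ (-k) = C ^ (-1 - k) * C := by
      rw [← Real.rpow_add_one hC0.ne']; congr 1; ring
    have e3 : C ^ (-k - 1) = C ^ (-1 - k) := by congr 1; ring
    rw [e1] at amgm
    rw [e2, e3]
    have := mul_le_mul_of_nonneg_left amgm (show 0 ≤ H * x ^ m by positivity)
    refine le_trans (le_of_eq ?_) (this.trans (le_of_eq ?_))
    · ring
    · have : x ^ 2 = C ^ 2 - 1 := by linarith
      linear_combination (H * x ^ m * k * C ^ (-1 - k)) * this

lemma two_mul_hypVol_three_le {ρ : ℝ} (h0 : 0 ≤ ρ) (h1 : ρ < 1) :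
    2 * hypVol 3 ρ ≤ 2 * ρ / (1 - ρ ^ 2) * ((1 + ρ ^ 2) / (1 - ρ ^ 2)) -
      3 * (2 * ρ / (1 - ρ ^ 2)) / (2 + (1 + ρ ^ 2) / (1 - ρ ^ 2)) := by
  refine hypVol_le_of_deriv
    (φ := fun ρ => 2 * ρ / (1 - ρ ^ 2) * ((1 + ρ ^ 2) / (1 - ρ ^ 2)) -
      3 * (2 * ρ / (1 - ρ ^ 2)) / (2 + (1 + ρ ^ 2) / (1 - ρ ^ 2))) ?_
    (fun t ht0 ht1 => ((hasDerivAt_poincare_sinh ht0 ht1).mul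
      (hasDerivAt_poincare_cosh ht0 ht1)).sub (((hasDerivAt_poincare_sinh ht0 ht1).const_mul 3).div
      ((hasDerivAt_poincare_cosh ht0 ht1).const_add 2)
      (by linarith [one_le_poincare_cosh ht0 ht1]))) ?_ h0 h1
  · simp
  · intro t ht0 ht1
    rw [poincare_density_eq (by omega)]
    have hC := one_le_poincare_cosh ht0.le ht1
    have hx := poincare_sinh_nonneg ht0.le ht1
    have hCx := poincare_cosh_sq ht0.le ht1
    have hh : 0 ≤ 2 / (1 - t ^ 2) := div_nonneg (by norm_num) (by nlinarith)
    generalize 2 / (1 - t ^ 2) = H at *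
    generalize (1 + t ^ 2) / (1 - t ^ 2) = C at *
    generalize 2 * t / (1 - t ^ 2) = x at *
    have key : (3 * (H * C) * (2 + C) - 3 * x * (H * x)) / (2 + C) ^ 2 ≤ H := by
      rw [div_le_iff₀ (by positivity)]
      have : 0 ≤ H * (C - 1) ^ 2 := by positivity
      nlinarith
    have : H * C * C + x * (H * x) = H + 2 * (H * x ^ 2) := by
      linear_combination H * hCx
    norm_num
    linarith

lemma hypVol_two_le {ρ : ℝ} (h0 : 0 ≤ ρ) (h1 : ρ < 1) :
    hypVol 2 ρ ≤ (1 + ρ ^ 2) / (1 - ρ ^ 2) - 1 := by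
  rw [← one_mul (hypVol 2 ρ)]
  refine hypVol_le_of_deriv (φ := fun ρ => (1 + ρ ^ 2) / (1 - ρ ^ 2) - 1) (by simp)
    (fun t ht0 ht1 => (hasDerivAt_poincare_cosh ht0 ht1).sub_const 1) ?_ h0 h1
  intro t _ _
  rw [poincare_density_eq (by omega)]
  simp

/-- The hyperbolic isoperimetric profile dominates the sum of the Euclidean one and the linear
Cheeger one, raised to the power `n`. -/
lemma isoperimetric_profile_nat {n : ℕ} (hn : 2 ≤ n) {ρ : ℝ} (h0 : 0 ≤ ρ) (h1 : ρ < 1) :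
    ((n : ℝ) * hypVol n ρ) ^ (n - 1) + (((n : ℝ) - 1) * hypVol n ρ) ^ n
      ≤ ((2 * ρ / (1 - ρ ^ 2)) ^ (n - 1)) ^ n := by
  have hs := hypVol_nonneg n h0 h1
  have hC := one_le_poincare_cosh h0 h1
  have hx := poincare_sinh_nonneg h0 h1
  have hCx := poincare_cosh_sq h0 h1
  rcases (show n = 2 ∨ n = 3 ∨ 4 ≤ n by omega) with rfl | rfl | h4
  · have h := hypVol_two_le h0 h1
    generalize (1 + ρ ^ 2) / (1 - ρ ^ 2) = C at *
    generalize 2 * ρ / (1 - ρ ^ 2) = x at *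
    generalize hypVol 2 ρ = s at *
    norm_num
    nlinarith
  · have h := two_mul_hypVol_three_le h0 h1
    generalize (1 + ρ ^ 2) / (1 - ρ ^ 2) = C at *
    generalize 2 * ρ / (1 - ρ ^ 2) = x at *
    generalize hypVol 3 ρ = s at *
    norm_num
    obtain ⟨B, hB⟩ : ∃ B, B = x * C - 3 * x / (2 + C) := ⟨_, rfl⟩
    rw [← hB] at h
    have hBe : B * (C + 2) = x * (C - 1) * (C + 3) := by
      rw [hB]; field_simp; ring
    have hxC : x ≤ C := by nlinarith
    have hB0 : 0 ≤ B := by linarith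
    have hx2 : x ^ 2 = (C - 1) * (C + 1) := by linarith
    have mono : (3 * s) ^ 2 + (2 * s) ^ 3 ≤ 9 / 4 * B ^ 2 + B ^ 3 := by
      have : (3 * s) ^ 2 = 9 / 4 * (2 * s) ^ 2 := by ring
      rw [this]
      gcongr
    refine mono.trans ?_
    have hpos : 0 < (C + 2) ^ 3 := by positivity
    refine le_of_mul_le_mul_right ?_ hpos
    have e1 : (9 / 4 * B ^ 2 + B ^ 3) * (C + 2) ^ 3
        = x ^ 2 * (C - 1) ^ 2 * (9 / 4 * (C + 3) ^ 2 * (C + 2) + x * (C - 1) * (C + 3) ^ 3) := by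
      have : (9 / 4 * B ^ 2 + B ^ 3) * (C + 2) ^ 3
        = 9 / 4 * (B * (C + 2)) ^ 2 * (C + 2) + (B * (C + 2)) ^ 3 := by ring
      rw [this, hBe]; ring
    have e2 : (x ^ 2) ^ 3 * (C + 2) ^ 3
        = x ^ 2 * (C - 1) ^ 2 * ((C + 1) ^ 2 * (C + 2) ^ 3) := by
      have : (x ^ 2) ^ 3 = x ^ 2 * (x ^ 2) ^ 2 := by ring
      rw [this]
      nth_rewrite 2 [hx2]
      ring
    rw [e1, e2]
    refine mul_le_mul_of_nonneg_left ?_ (by positivity)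
    have : x * (C - 1) * (C + 3) ^ 3 ≤ C * (C - 1) * (C + 3) ^ 3 := by
      have : 0 ≤ C - 1 := by linarith
      gcongr
    have poly : 0 ≤ 19 * C ^ 3 + 80 * C ^ 2 + 31 * C - 130 := by
      nlinarith [pow_le_pow_left₀ zero_le_one hC 2, pow_le_pow_left₀ zero_le_one hC 3]
    nlinarith
  · have ha := mul_hypVol_le h4 h0 h1
    have hb := sub_one_mul_hypVol_le hn h0 h1
    generalize (1 + ρ ^ 2) / (1 - ρ ^ 2) = C at *
    generalize 2 * ρ / (1 - ρ ^ 2) = x at *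
    generalize hypVol n ρ = s at *
    have hC0 : 0 < C := by linarith
    have hnR : (4 : ℝ) ≤ n := by exact_mod_cast h4
    have h3 : ((n : ℝ) * s) ^ (n - 1) ≤ (x ^ (n - 1)) ^ n * (1 / C ^ 2) := by
      refine (pow_le_pow_left₀ (by positivity) ha (n - 1)).trans (le_of_eq ?_)
      rw [mul_pow, ← pow_mul, ← pow_mul, mul_comm n (n - 1), ← Real.rpow_natCast (C ^ _) (n - 1),
        ← Real.rpow_mul hC0.le]
      have : -(2 / ((n : ℝ) - 1)) * ((n - 1 : ℕ) : ℝ) = -(2 : ℕ) := by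
        rw [Nat.cast_sub (by omega)]
        have : (n : ℝ) - 1 ≠ 0 := by linarith
        push_cast
        field_simp
      rw [this, Real.rpow_neg hC0.le, Real.rpow_natCast, one_div]
    have h5 : (((n : ℝ) - 1) * s) ^ n ≤ (x ^ (n - 1)) ^ n * (1 - 1 / C ^ 2) := by
      have e : x ^ n / C = x ^ (n - 1) * (x / C) := by
        obtain ⟨m, rfl⟩ := Nat.exists_eq_add_of_le' (show 1 ≤ n by omega)
        simp only [Nat.add_sub_cancel]; ring
      refine (pow_le_pow_left₀ (mul_nonneg (by linarith) hs) hb n).trans ?_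
      rw [e, mul_pow]
      refine mul_le_mul_of_nonneg_left ?_ (by positivity)
      have hxC : x ≤ C := by nlinarith
      have : (x / C) ^ n ≤ (x / C) ^ 2 :=
        pow_le_pow_of_le_one (by positivity) (by rw [div_le_one hC0]; exact hxC) hn
      refine this.trans (le_of_eq ?_)
      field_simp
      linarith
    calc _ ≤ _ := add_le_add h3 h5
      _ = _ := by ring

lemma isoperimetric_profile_rpow {n : ℕ} (hn : 2 ≤ n) {p : ℝ} (hp : (n : ℝ) < p)
    {ρ : ℝ} (h0 : 0 ≤ ρ) (h1 : ρ < 1) :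
    ((n : ℝ) * hypVol n ρ) ^ (p * (n - 1) / n) + (((n : ℝ) - 1) * hypVol n ρ) ^ p
      ≤ ((2 * ρ / (1 - ρ ^ 2)) ^ (n - 1)) ^ p := by
  have hs := hypVol_nonneg n h0 h1
  have hx := poincare_sinh_nonneg h0 h1
  have hnR : (2 : ℝ) ≤ n := by exact_mod_cast hn
  have key := isoperimetric_profile_nat hn h0 h1
  generalize 2 * ρ / (1 - ρ ^ 2) = x at *
  generalize hypVol n ρ = s at *
  have hb : 0 ≤ ((n : ℝ) - 1) * s := mul_nonneg (by linarith) hs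
  have h := Real.add_rpow_le_rpow_add (p := p / n) (a := ((n : ℝ) * s) ^ (n - 1))
    (b := (((n : ℝ) - 1) * s) ^ n) (by positivity) (pow_nonneg hb n)
    (by rw [one_le_div (by linarith)]; exact hp.le)
  have h2 := h.trans (Real.rpow_le_rpow
    (add_nonneg (by positivity) (pow_nonneg hb n)) key (div_nonneg (by linarith) (by linarith)))
  rw [← Real.rpow_natCast _ (n - 1), ← Real.rpow_natCast _ n, ← Real.rpow_natCast (x ^ (n - 1)) n,
    ← Real.rpow_mul (show 0 ≤ (n : ℝ) * s by positivity), ← Real.rpow_mul hb,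
    ← Real.rpow_mul (show 0 ≤ x ^ (n - 1) by positivity),
    Nat.cast_sub (by omega)] at h2
  have e1 : (n : ℝ) * (p / n) = p := by field_simp
  have e2 : ((n : ℝ) - (1 : ℕ)) * (p / n) = p * (n - 1) / n := by push_cast; ring
  rw [e1, e2] at h2
  exact h2

lemma weighted_young {p k z c : ℝ} (hp : 1 < p) (hk : 0 < k) (hz : 0 ≤ z) (hc : 0 ≤ c) :
    p * c * z - (p - 1) * c ^ (p / (p - 1)) * k ^ (-(1 / (p - 1))) ≤ k * z ^ p := by
  have hp0 : 0 < p := by linarith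
  have hq : p.HolderConjugate (p / (p - 1)) := Real.HolderConjugate.conjExponent hp
  have h := Real.young_inequality_of_nonneg (a := k ^ (1 / p) * z) (b := c * k ^ (-(1 / p)))
    (by positivity) (by positivity) hq
  rw [Real.mul_rpow (by positivity) hz, Real.mul_rpow hc (by positivity), ← Real.rpow_mul hk.le,
    ← Real.rpow_mul hk.le] at h
  have e1 : k ^ (1 / p) * z * (c * k ^ (-(1 / p))) = c * z := by
    have : k ^ (1 / p) * k ^ (-(1 / p)) = 1 := by
      rw [← Real.rpow_add hk]; simp
    linear_combination (c * z) * this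
  have hp1 : p - 1 ≠ 0 := by linarith
  have e2 : 1 / p * p = 1 := by field_simp
  have e3 : -(1 / p) * (p / (p - 1)) = -(1 / (p - 1)) := by field_simp
  rw [e1, e2, e3, Real.rpow_one] at h
  have h2 := mul_le_mul_of_nonneg_left h hp0.le
  have e4 : p * (k * z ^ p / p + c ^ (p / (p - 1)) * k ^ (-(1 / (p - 1))) / (p / (p - 1)))
     = k * z ^ p + (p - 1) * c ^ (p / (p - 1)) * k ^ (-(1 / (p - 1))) := by
    field_simp
  rw [e4] at h2
  linarith

lemma young_tangent {p z t : ℝ} (hp : 1 < p) (hz : 0 ≤ z) (ht : 0 ≤ t) :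
    p * t ^ (p - 1) * z - (p - 1) * t ^ p ≤ z ^ p := by
  have h := weighted_young hp one_pos hz (Real.rpow_nonneg ht (p - 1))
  rw [← Real.rpow_mul ht, mul_div_cancel₀ _ (by linarith : p - 1 ≠ 0), Real.one_rpow] at h
  linarith

/-- The extremal weight of the sharp Morrey inequality, as a function of the enclosed volume. -/
noncomputable def morreyWeight (n : ℕ) (p s : ℝ) : ℝ :=
  ((n : ℝ) * s) ^ (-(p * (n - 1) / (n * (p - 1))))

lemma radial_energy_ge {n : ℕ} (hn : 2 ≤ n) {p : ℝ} (hp : (n : ℝ) < p) {c : ℝ} (hc : 0 ≤ c)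
    {ρ : ℝ} (h0 : 0 < ρ) (h1 : ρ < 1) {f f' D : ℝ} (hD : |f'| ≤ D) :
    -((n - 1) ^ p * (p * p ^ (-p))) * ((2 / (1 - ρ ^ 2)) ^ n * ρ ^ (n - 1) * |f| ^ p
        + hypVol n ρ * (p * |f| ^ (p - 2) * f * f')) - p * c * f'
      ≤ ρ ^ (n - 1) * (((1 - ρ ^ 2) / 2) ^ p * D ^ p * (2 / (1 - ρ ^ 2)) ^ n
        - ((n - 1) / p) ^ p * (|f| ^ p * (2 / (1 - ρ ^ 2)) ^ n)
        + (p - 1) * c ^ (p / (p - 1)) * (morreyWeight n p (hypVol n ρ)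
          * (2 / (1 - ρ ^ 2)) ^ n)) := by
  have hnR : (2 : ℝ) ≤ n := by exact_mod_cast hn
  have hp1 : 1 < p := by linarith
  have hD0 : 0 ≤ D := (abs_nonneg _).trans hD
  have hs := hypVol_pos n h0 h1
  have iso := isoperimetric_profile_rpow hn hp h0.le h1
  have hρ : 0 < 1 - ρ ^ 2 := by nlinarith
  have hS : 0 < 2 * ρ / (1 - ρ ^ 2) := by positivity
  have dens := poincare_density_eq (n := n) (by omega) ρ
  have hinv : (1 - ρ ^ 2) / 2 = 1 / (2 / (1 - ρ ^ 2)) := by field_simp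
  rw [hinv]
  have hH : 0 < 2 / (1 - ρ ^ 2) := by positivity
  generalize 2 / (1 - ρ ^ 2) = H at *
  generalize hSd : (2 * ρ / (1 - ρ ^ 2)) ^ (n - 1) = S at *
  have hS' : 0 < S := by rw [← hSd]; positivity
  generalize hypVol n ρ = s at *
  obtain ⟨s', hs'⟩ : ∃ s', s' = H * S := ⟨_, rfl⟩
  have hs'0 : 0 < s' := by rw [hs']; positivity
  obtain ⟨z, hz⟩ : ∃ z, z = D / (H * S) := ⟨_, rfl⟩
  have hz0 : 0 ≤ z := by rw [hz]; positivity
  have hzs : z * s' = D := by rw [hz, hs']; field_simp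
  obtain ⟨k, hk⟩ : ∃ k, k = ((n : ℝ) * s) ^ (p * (n - 1) / n) := ⟨_, rfl⟩
  have hk0 : 0 < k := by rw [hk]; positivity
  have hw : morreyWeight n p s = k ^ (-(1 / (p - 1))) := by
    rw [hk, ← Real.rpow_mul (by positivity), morreyWeight]
    congr 1
    have : p - 1 ≠ 0 := by linarith
    field_simp
  rw [hw]
  have B1 := weighted_young hp1 hk0 hz0 hc
  have B2 := young_tangent hp1 (show 0 ≤ s * z by positivity)
    (show 0 ≤ |f| / p from div_nonneg (abs_nonneg _) (by linarith))
  have hN0 : (0 : ℝ) ≤ n - 1 := by linarith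
  obtain ⟨P, hP⟩ : ∃ P, P = p ^ (-p) := ⟨_, rfl⟩
  have hP0 : 0 < P := by rw [hP]; exact Real.rpow_pos_of_pos (by linarith) _
  have ed (a : ℝ) (ha : 0 ≤ a) : (a / p) ^ p = a ^ p * P := by
    rw [Real.div_rpow ha (by linarith), hP, Real.rpow_neg (by linarith), div_eq_mul_inv]
  have ed1 : (|f| / p) ^ (p - 1) = |f| ^ (p - 1) * (p * P) := by
    rw [Real.div_rpow (abs_nonneg _) (by linarith), hP, div_eq_mul_inv,
      ← Real.rpow_neg (by linarith), mul_comm p, ← Real.rpow_add_one (by linarith)]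
    congr 2; ring
  rw [ed _ (abs_nonneg _), ed1] at B2
  rw [ed _ hN0, ← hP, dens, ← hs']
  have eDp : (1 / H) ^ p * D ^ p = S ^ p * z ^ p := by
    rw [← Real.mul_rpow (by positivity) hD0, ← Real.mul_rpow hS'.le hz0]
    congr 1
    rw [hz]; field_simp
  have eF : |f| ^ (p - 2) * |f| = |f| ^ (p - 1) := by
    rw [← Real.rpow_add_one' (abs_nonneg _) (by linarith)]
    congr 1; ring
  have hGf : -(|f| ^ (p - 1) * D) ≤ |f| ^ (p - 2) * f * f' := by
    have h3 : |(|f| ^ (p - 2) * f * f')| ≤ |f| ^ (p - 1) * D := by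
      rw [abs_mul, abs_mul, abs_of_nonneg (Real.rpow_nonneg (abs_nonneg f) _), eF]
      gcongr
    exact neg_le_of_abs_le h3
  generalize |f| ^ p = F at *
  generalize |f| ^ (p - 1) = F1 at *
  generalize hG : |f| ^ (p - 2) * f * f' = G at *
  have e5 : p * |f| ^ (p - 2) * f * f' = p * G := by rw [← hG]; ring
  rw [e5]
  have hcf : -D ≤ f' := (abs_le.mp hD).1
  have hEz : s' * ((k + ((n : ℝ) - 1) ^ p * s ^ p) * z ^ p) ≤ s' * (S ^ p * z ^ p) := by
    rw [← Real.mul_rpow hN0 hs.le, hk]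
    gcongr
  rw [Real.mul_rpow hs.le hz0] at B2
  have hN : 0 ≤ ((n : ℝ) - 1) ^ p := Real.rpow_nonneg hN0 _
  generalize ((n : ℝ) - 1) ^ p = N at *
  have eR : ρ ^ (n - 1) * ((1 / H) ^ p * D ^ p * H ^ n - N * P * (F * H ^ n) +
      (p - 1) * c ^ (p / (p - 1)) * (k ^ (-(1 / (p - 1))) * H ^ n))
      = s' * (S ^ p * z ^ p) - N * P * F * s'
        + s' * ((p - 1) * c ^ (p / (p - 1)) * k ^ (-(1 / (p - 1)))) := by
    rw [eDp, hs', ← dens]; ring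
  rw [eR]
  have C1 := mul_le_mul_of_nonneg_left B1 hs'0.le
  have C2 := mul_le_mul_of_nonneg_left B2 (mul_nonneg hs'0.le hN)
  have C3 := mul_le_mul_of_nonneg_left hGf (show 0 ≤ N * (p * P) * s * p by positivity)
  have C4 := mul_le_mul_of_nonneg_left hcf (show 0 ≤ p * c by positivity)
  have e6 : s' * N * (p * (F1 * (p * P)) * (s * z)) = N * (p * P) * s * p * (F1 * D) := by
    rw [← hzs]; ring
  have e7 : s' * (p * c * z) = p * c * D := by rw [← hzs]; ring
  linarith

lemma integral_ge_of_forall_ray {E : Type*} [NormedAddCommGroup E] [NormedSpace ℝ E]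
    [FiniteDimensional ℝ E] [MeasurableSpace E] [BorelSpace E] [Nontrivial E] (μ : Measure E)
    [μ.IsAddHaarMeasure] {F : E → ℝ} (hF : Integrable F μ) {m : ℝ}
    (hm : ∀ θ : E, ‖θ‖ = 1 →
      IntegrableOn (fun ρ : ℝ => ρ ^ (Module.finrank ℝ E - 1) * F (ρ • θ)) (Set.Ioi 0) →
      m ≤ ∫ ρ in Set.Ioi (0 : ℝ), ρ ^ (Module.finrank ℝ E - 1) * F (ρ • θ)) :
    (Module.finrank ℝ E * μ.real (Metric.ball 0 1)) * m ≤ ∫ x, F x ∂μ := by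
  have mp := μ.measurePreserving_homeomorphUnitSphereProd.symm
    (homeomorphUnitSphereProd E).toMeasurableEquiv
  set G : Metric.sphere (0 : E) 1 × Set.Ioi (0 : ℝ) → ℝ := fun y => F (y.2.1 • y.1.1) with hG
  have hme : MeasurableEmbedding (homeomorphUnitSphereProd E).toMeasurableEquiv.symm :=
    MeasurableEquiv.measurableEmbedding _
  have hGc : G = (fun x : ({(0)}ᶜ : Set E) => F x.1) ∘
      (homeomorphUnitSphereProd E).toMeasurableEquiv.symm := by
    funext y
    rfl
  have h0 : Integrable (fun x : ({(0)}ᶜ : Set E) => F x.1) (μ.comap (↑)) := by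
    have : IntegrableOn F ({(0)}ᶜ : Set E) μ := hF.integrableOn
    rwa [integrableOn_iff_comap_subtypeVal (by measurability)] at this
  have hGi : Integrable G (μ.toSphere.prod (.volumeIoiPow (Module.finrank ℝ E - 1))) := by
    rw [hGc]
    exact (mp.integrable_comp_emb hme).mpr h0
  have h_int : ∫ x, F x ∂μ
      = ∫ y, G y ∂(μ.toSphere.prod (.volumeIoiPow (Module.finrank ℝ E - 1))) := by
    rw [hGc]
    simp only [Function.comp_apply]
    rw [mp.integral_comp hme (fun x : ({(0)}ᶜ : Set E) => F x.1),
      integral_subtype_comap (measurableSet_singleton _).compl fun x ↦ F x,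
      restrict_compl_singleton]
  rw [h_int, integral_prod _ hGi, ← Measure.toSphere_real_apply_univ]
  have hconst : μ.toSphere.real Set.univ * m = ∫ _θ, m ∂μ.toSphere := by simp
  rw [hconst]
  refine integral_mono_ae (integrable_const m) hGi.integral_prod_left ?_
  filter_upwards [hGi.prod_right_ae] with θ hθ
  have hmeas : Measurable fun r : Set.Ioi (0 : ℝ) =>
      Real.toNNReal (r.1 ^ (Module.finrank ℝ E - 1)) :=
    (measurable_subtype_coe.pow_const _).real_toNNReal
  have e1 : ∫ r, G (θ, r) ∂(Measure.volumeIoiPow (Module.finrank ℝ E - 1))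
      = ∫ ρ in Set.Ioi (0 : ℝ), ρ ^ (Module.finrank ℝ E - 1) * F (ρ • θ.1) := by
    simp only [Measure.volumeIoiPow, ENNReal.ofReal]
    rw [integral_withDensity_eq_integral_smul hmeas,
      integral_subtype_comap measurableSet_Ioi
        fun a ↦ Real.toNNReal (a ^ (Module.finrank ℝ E - 1)) • F (a • θ.1),
      setIntegral_congr_fun measurableSet_Ioi fun x hx ↦ ?_]
    simp only [NNReal.smul_def, Real.coe_toNNReal _ (pow_nonneg (le_of_lt hx) _), smul_eq_mul]
  have e2 : IntegrableOn (fun ρ : ℝ => ρ ^ (Module.finrank ℝ E - 1) * F (ρ • θ.1))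
      (Set.Ioi 0) := by
    rw [integrableOn_iff_comap_subtypeVal measurableSet_Ioi]
    simp only [Measure.volumeIoiPow, ENNReal.ofReal] at hθ
    rw [integrable_withDensity_iff_integrable_smul hmeas] at hθ
    refine hθ.congr (.of_forall fun r => ?_)
    simp only [NNReal.smul_def, Real.coe_toNNReal _ (pow_nonneg (le_of_lt r.2) _), smul_eq_mul,
      Function.comp_apply, hG]
  have := hm θ.1 (by simp) e2
  simpa [e1] using this

lemma integral_ball_fun_norm {n : ℕ} (hn : 0 < n) {g G : ℝ → ℝ} {r : ℝ} (hr : 0 ≤ r)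
    (hG : ContinuousOn G (Set.Icc 0 r))
    (hd : ∀ x ∈ Set.Ioo 0 r, HasDerivAt G (x ^ (n - 1) * g x) x)
    (hg : ∀ x ∈ Set.Ioo 0 r, 0 ≤ g x) :
    IntegrableOn (fun x : EuclideanSpace ℝ (Fin n) => g ‖x‖) (Metric.ball 0 r) ∧
    ∫ x in Metric.ball (0 : EuclideanSpace ℝ (Fin n)) r, g ‖x‖
      = (n * volume.real (Metric.ball (0 : EuclideanSpace ℝ (Fin n)) 1)) * (G r - G 0) := by
  have : Nontrivial (EuclideanSpace ℝ (Fin n)) :=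
    Module.nontrivial_of_finrank_pos (R := ℝ) (by simpa using hn)
  have hpos : ∀ x ∈ Set.Ioo 0 r, 0 ≤ x ^ (n - 1) * g x :=
    fun x hx => mul_nonneg (pow_nonneg hx.1.le _) (hg x hx)
  have h_int := intervalIntegral.integrableOn_deriv_of_nonneg hG hd hpos
  constructor
  · rw [integrableOn_fun_norm_addHaar]
    simpa [smul_eq_mul] using h_int.mono_set Set.Ioo_subset_Ioc_self
  · have h1 : ∫ x in Metric.ball (0 : EuclideanSpace ℝ (Fin n)) r, g ‖x‖
        = ∫ x : EuclideanSpace ℝ (Fin n), (Set.Iio r).indicator g ‖x‖ := by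
      rw [← integral_indicator Metric.isOpen_ball.measurableSet]
      congr 1
      funext x
      simp [Set.indicator]
    rw [h1, integral_fun_norm_addHaar]
    have h2 : ∫ y in Set.Ioi (0 : ℝ), y ^ (Module.finrank ℝ (EuclideanSpace ℝ (Fin n)) - 1) •
        (Set.Iio r).indicator g y = G r - G 0 := by
      rw [← intervalIntegral.integral_eq_sub_of_hasDerivAt_of_le hr hG hd
        ((intervalIntegrable_iff_integrableOn_Ioc_of_le hr).mpr h_int),
        intervalIntegral.integral_of_le hr, integral_Ioc_eq_integral_Ioo,
        ← integral_indicator measurableSet_Ioi, ← integral_indicator measurableSet_Ioo]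
      congr 1
      funext x
      by_cases h0 : 0 < x <;> by_cases h1 : x < r <;> simp [Set.indicator, h0, h1]
    rw [h2]
    simp [mul_assoc]

lemma integral_ball_density {n : ℕ} (hn : 0 < n) {r : ℝ} (h0 : 0 ≤ r) (h1 : r < 1) :
    IntegrableOn (fun x : EuclideanSpace ℝ (Fin n) => (2 / (1 - ‖x‖ ^ 2)) ^ n)
      (Metric.ball 0 r) ∧
    ∫ x in Metric.ball (0 : EuclideanSpace ℝ (Fin n)) r, (2 / (1 - ‖x‖ ^ 2)) ^ n
      = (n * volume.real (Metric.ball (0 : EuclideanSpace ℝ (Fin n)) 1)) * hypVol n r := by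
  have := integral_ball_fun_norm hn (g := fun t => (2 / (1 - t ^ 2)) ^ n) (G := hypVol n) h0
    ((continuousOn_hypVol n).mono fun x hx => ⟨hx.1, hx.2.trans_lt h1⟩)
    (fun x hx => by
      simpa [mul_comm] using hasDerivAt_hypVol n hx.1.le (hx.2.trans h1))
    (fun x hx => by
      have : 0 < 1 - x ^ 2 := by nlinarith [hx.1, hx.2]
      positivity)
  simpa [hypVol_zero] using this

lemma morreyWeight_nonneg (n : ℕ) (p : ℝ) {s : ℝ} (hs : 0 ≤ s) : 0 ≤ morreyWeight n p s :=
  Real.rpow_nonneg (by positivity) _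

lemma integral_ball_morreyWeight {n : ℕ} (hn : 2 ≤ n) {p : ℝ} (hp : (n : ℝ) < p) {r : ℝ}
    (h0 : 0 ≤ r) (h1 : r < 1) :
    IntegrableOn (fun x : EuclideanSpace ℝ (Fin n) =>
      morreyWeight n p (hypVol n ‖x‖) * (2 / (1 - ‖x‖ ^ 2)) ^ n) (Metric.ball 0 r) ∧
    ∫ x in Metric.ball (0 : EuclideanSpace ℝ (Fin n)) r,
      morreyWeight n p (hypVol n ‖x‖) * (2 / (1 - ‖x‖ ^ 2)) ^ n
      = (n * volume.real (Metric.ball (0 : EuclideanSpace ℝ (Fin n)) 1)) *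
        ((p - 1) / (p - n) * (n * hypVol n r) ^ ((p - n) / (n * (p - 1)))) := by
  have hnR : (2 : ℝ) ≤ n := by exact_mod_cast hn
  have e : (0 : ℝ) < (p - n) / (n * (p - 1)) := by
    have : 0 < p - n := by linarith
    have : 0 < p - 1 := by linarith
    positivity
  have := integral_ball_fun_norm (by omega : 0 < n)
    (g := fun t => morreyWeight n p (hypVol n t) * (2 / (1 - t ^ 2)) ^ n)
    (G := fun t => (p - 1) / (p - n) * (n * hypVol n t) ^ ((p - n) / (n * (p - 1)))) h0
    (by
      refine continuousOn_const.mul ?_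
      refine ContinuousOn.rpow_const ?_ (fun x _ => Or.inr e.le)
      exact continuousOn_const.mul
        ((continuousOn_hypVol n).mono fun x hx => ⟨hx.1, hx.2.trans_lt h1⟩))
    (fun x hx => by
      have hs := hypVol_pos n hx.1 (hx.2.trans h1)
      have hns : (n : ℝ) * hypVol n x ≠ 0 := by positivity
      have := (((hasDerivAt_hypVol n hx.1.le (hx.2.trans h1)).const_mul (n : ℝ)).rpow_const
        (p := (p - n) / (n * (p - 1))) (Or.inl hns)).const_mul ((p - 1) / (p - n))
      refine this.congr_deriv ?_
      have e2 : (p - n) / (n * (p - 1)) - 1 = -(p * (n - 1) / (n * (p - 1))) := by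
        have : p - 1 ≠ 0 := by linarith
        field_simp
        ring
      rw [e2, ← morreyWeight]
      have : p - 1 ≠ 0 := by linarith
      have : p - n ≠ 0 := by linarith
      field_simp)
    (fun x hx => by
      have : 0 < 1 - x ^ 2 := by nlinarith [hx.1, hx.2]
      have := morreyWeight_nonneg n p (hypVol_nonneg n hx.1.le (hx.2.trans h1))
      positivity)
  simpa [hypVol_zero, Real.zero_rpow e.ne'] using this

lemma fderiv_eq_zero_of_forall_notMem {E : Type*} [NormedAddCommGroup E] [NormedSpace ℝ E]
    {v : E → ℝ} {K : Set E} (hK : IsClosed K) (hvK : ∀ x ∉ K, v x = 0) {x : E} (hx : x ∉ K) :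
    fderiv ℝ v x = 0 := by
  have : v =ᶠ[nhds x] fun _ => 0 := by
    filter_upwards [hK.isOpen_compl.mem_nhds hx] with y hy using hvK y hy
  rw [this.fderiv_eq]
  simp

lemma one_sub_norm_sq_pos {E : Type*} [NormedAddCommGroup E] {r : ℝ} (hr1 : r ≤ 1) {x : E}
    (hx : x ∈ Metric.ball (0 : E) r) : 0 < 1 - ‖x‖ ^ 2 := by
  have := mem_ball_zero_iff.mp hx
  nlinarith [norm_nonneg x]

lemma continuousOn_density {E : Type*} [NormedAddCommGroup E] (n : ℕ) {r : ℝ} (hr1 : r ≤ 1)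
    {K : Set E} (hKr : K ⊆ Metric.ball 0 r) :
    ContinuousOn (fun x : E => (2 / (1 - ‖x‖ ^ 2)) ^ n) K :=
  ContinuousOn.pow (ContinuousOn.div continuousOn_const (by fun_prop)
    fun x hx => (one_sub_norm_sq_pos hr1 (hKr hx)).ne') n

lemma energy_sub_mass_ge {n : ℕ} (hn : 2 ≤ n) {p : ℝ} (hp : (n : ℝ) < p) {c : ℝ} (hc : 0 ≤ c)
    {v : EuclideanSpace ℝ (Fin n) → ℝ} (hv : ContDiff ℝ 1 v) {K : Set (EuclideanSpace ℝ (Fin n))}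
    (hK : IsCompact K) {r : ℝ} (hr0 : 0 < r) (hr1 : r < 1) (hKr : K ⊆ Metric.ball 0 r)
    (hvK : ∀ x ∉ K, v x = 0) :
    (n * volume.real (Metric.ball (0 : EuclideanSpace ℝ (Fin n)) 1)) * (p * c * v 0)
      ≤ (∫ x in K, ((1 - ‖x‖ ^ 2) / 2) ^ p * ‖fderiv ℝ v x‖ ^ p * (2 / (1 - ‖x‖ ^ 2)) ^ n)
        - ((n - 1) / p) ^ p * (∫ x in K, |v x| ^ p * (2 / (1 - ‖x‖ ^ 2)) ^ n)
        + (p - 1) * c ^ (p / (p - 1)) *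
          ∫ x in K, morreyWeight n p (hypVol n ‖x‖) * (2 / (1 - ‖x‖ ^ 2)) ^ n := by
  have hnR : (2 : ℝ) ≤ n := by exact_mod_cast hn
  have hp1 : 1 < p := by linarith
  have : Nontrivial (EuclideanSpace ℝ (Fin n)) :=
    Module.nontrivial_of_finrank_pos (R := ℝ) (by simp; omega)
  have hdens := continuousOn_density n hr1.le hKr
  have i1 : IntegrableOn (fun x => ((1 - ‖x‖ ^ 2) / 2) ^ p * ‖fderiv ℝ v x‖ ^ p *
      (2 / (1 - ‖x‖ ^ 2)) ^ n) K := by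
    refine ContinuousOn.integrableOn_compact hK (ContinuousOn.mul (Continuous.continuousOn ?_) hdens)
    have := hv.continuous_fderiv one_ne_zero
    exact (Continuous.rpow_const (by fun_prop) fun _ => Or.inr (by linarith)).mul
      (Continuous.rpow_const (by fun_prop) fun _ => Or.inr (by linarith))
  have i2 : IntegrableOn (fun x => |v x| ^ p * (2 / (1 - ‖x‖ ^ 2)) ^ n) K := by
    refine ContinuousOn.integrableOn_compact hK (ContinuousOn.mul (Continuous.continuousOn ?_) hdens)
    exact Continuous.rpow_const hv.continuous.abs fun _ => Or.inr (by linarith)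
  have i3 : IntegrableOn (fun x : EuclideanSpace ℝ (Fin n) =>
      morreyWeight n p (hypVol n ‖x‖) * (2 / (1 - ‖x‖ ^ 2)) ^ n) K :=
    (integral_ball_morreyWeight hn hp hr0.le hr1).1.mono_set hKr
  obtain ⟨F, hF⟩ : ∃ F : EuclideanSpace ℝ (Fin n) → ℝ, F = fun x =>
    ((1 - ‖x‖ ^ 2) / 2) ^ p * ‖fderiv ℝ v x‖ ^ p * (2 / (1 - ‖x‖ ^ 2)) ^ n
        - ((n - 1) / p) ^ p * (|v x| ^ p * (2 / (1 - ‖x‖ ^ 2)) ^ n)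
        + (p - 1) * c ^ (p / (p - 1)) *
          (morreyWeight n p (hypVol n ‖x‖) * (2 / (1 - ‖x‖ ^ 2)) ^ n) := ⟨_, rfl⟩
  have iF : IntegrableOn F K := by
    rw [hF]
    exact (i1.sub (i2.const_mul _)).add (i3.const_mul _)
  have hrhs : (∫ x in K, ((1 - ‖x‖ ^ 2) / 2) ^ p * ‖fderiv ℝ v x‖ ^ p * (2 / (1 - ‖x‖ ^ 2)) ^ n)
        - ((n - 1) / p) ^ p * (∫ x in K, |v x| ^ p * (2 / (1 - ‖x‖ ^ 2)) ^ n)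
        + (p - 1) * c ^ (p / (p - 1)) *
          ∫ x in K, morreyWeight n p (hypVol n ‖x‖) * (2 / (1 - ‖x‖ ^ 2)) ^ n
      = ∫ x, K.indicator F x := by
    rw [integral_indicator hK.measurableSet, hF, ← integral_const_mul, ← integral_const_mul,
      ← integral_sub i1 (i2.const_mul _)]
    exact (integral_add (i1.sub (i2.const_mul _)) (i3.const_mul _)).symm
  rw [hrhs]
  have hfr : Module.finrank ℝ (EuclideanSpace ℝ (Fin n)) = n := by simp
  have key := integral_ge_of_forall_ray (volume : Measure (EuclideanSpace ℝ (Fin n)))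
    (F := K.indicator F) (m := p * c * v 0) (iF.integrable_indicator hK.measurableSet) ?_
  · rwa [hfr] at key
  rw [hfr]
  intro θ hθ hI
  have hnorm {ρ : ℝ} (h : 0 ≤ ρ) : ‖ρ • θ‖ = ρ := by
    rw [norm_smul, hθ, mul_one, Real.norm_of_nonneg h]
  have hout {ρ : ℝ} (h : r ≤ ρ) : ρ • θ ∉ K := fun hmem => by
    have := mem_ball_zero_iff.mp (hKr hmem)
    rw [hnorm (hr0.le.trans h)] at this
    linarith
  have hset : ∫ ρ in Set.Ioi (0 : ℝ), ρ ^ (n - 1) * K.indicator F (ρ • θ)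
      = ∫ ρ in (0 : ℝ)..r, ρ ^ (n - 1) * K.indicator F (ρ • θ) := by
    rw [intervalIntegral.integral_of_le hr0.le]
    refine setIntegral_eq_of_subset_of_forall_sdiff_eq_zero measurableSet_Ioi
      Set.Ioc_subset_Ioi_self fun ρ hρ => ?_
    have : r ≤ ρ := by
      by_contra! h
      exact hρ.2 ⟨hρ.1, h.le⟩
    rw [Set.indicator_of_notMem (hout this), mul_zero]
  rw [hset]
  have hf (ρ : ℝ) : HasDerivAt (fun t : ℝ => v (t • θ)) (fderiv ℝ v (ρ • θ) θ) ρ := by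
    have h1 : HasDerivAt (fun t : ℝ => t • θ) θ ρ := by
      simpa using (hasDerivAt_id ρ).smul_const θ
    exact ((hv.differentiable one_ne_zero _).hasFDerivAt).comp_hasDerivAt ρ h1
  have hcf : Continuous fun t : ℝ => v (t • θ) := by
    have := hv.continuous
    fun_prop
  have := intervalIntegral.sub_le_integral_of_hasDeriv_right_of_le (a := 0) (b := r) hr0.le
    (g := fun t => -((n - 1) ^ p * (p * p ^ (-p))) * (hypVol n t * |v (t • θ)| ^ p)
      - p * c * v (t • θ))
    (g' := fun t => -((n - 1) ^ p * (p * p ^ (-p))) *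
      ((2 / (1 - t ^ 2)) ^ n * t ^ (n - 1) * |v (t • θ)| ^ p
        + hypVol n t * (p * |v (t • θ)| ^ (p - 2) * v (t • θ) * fderiv ℝ v (t • θ) θ))
      - p * c * fderiv ℝ v (t • θ) θ)
    (φ := fun ρ => ρ ^ (n - 1) * K.indicator F (ρ • θ)) ?_ ?_ ?_ ?_
  · simp only [hypVol_zero, hvK _ (hout le_rfl)] at this
    simpa [Real.zero_rpow (by linarith : p ≠ 0)] using this
  · refine ContinuousOn.sub (continuousOn_const.mul (ContinuousOn.mul
      ((continuousOn_hypVol n).mono fun x hx => ⟨hx.1, hx.2.trans_lt hr1⟩)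
      (Continuous.continuousOn ?_))) (continuous_const.mul hcf).continuousOn
    exact Continuous.rpow_const hcf.abs fun _ => Or.inr (by linarith)
  · intro ρ hρ
    refine HasDerivAt.hasDerivWithinAt ?_
    have h2 : HasDerivAt (fun t : ℝ => |v (t • θ)| ^ p)
        (p * |v (ρ • θ)| ^ (p - 2) * v (ρ • θ) * fderiv ℝ v (ρ • θ) θ) ρ :=
      HasDerivAt.comp (h₂ := fun x : ℝ => |x| ^ p) ρ (hasDerivAt_abs_rpow (v (ρ • θ)) hp1) (hf ρ)
    exact (((hasDerivAt_hypVol n hρ.1.le (hρ.2.trans hr1)).mul h2).const_mul _).sub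
      ((hf ρ).const_mul _)
  · have : IntegrableOn (fun ρ : ℝ => ρ ^ (n - 1) * K.indicator F (ρ • θ)) (Set.Ioc 0 r) :=
      hI.mono_set Set.Ioc_subset_Ioi_self |>.congr_fun (fun ρ _ => by simp) measurableSet_Ioc
    rwa [integrableOn_Icc_iff_integrableOn_Ioc]
  · intro ρ hρ
    by_cases hmem : ρ • θ ∈ K
    · have h := radial_energy_ge hn hp hc hρ.1 (hρ.2.trans hr1) (f := v (ρ • θ))
        (f' := fderiv ℝ v (ρ • θ) θ) (D := ‖fderiv ℝ v (ρ • θ)‖) (by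
          simpa [hθ] using (fderiv ℝ v (ρ • θ)).le_opNorm θ)
      simpa only [Set.indicator_of_mem hmem, hF, hnorm hρ.1.le] using h
    · simp [Set.indicator_of_notMem hmem, hvK _ hmem,
        fderiv_eq_zero_of_forall_notMem hK.isClosed hvK hmem,
        Real.zero_rpow (by linarith : p ≠ 0)]

lemma volume_real_ball_eq_unitBallVol {n : ℕ} (hn : 0 < n) :
    volume.real (Metric.ball (0 : EuclideanSpace ℝ (Fin n)) 1) = unitBallVol n := by
  have : Nonempty (Fin n) := ⟨⟨0, hn⟩⟩
  have hg : 0 < Real.Gamma ((n : ℝ) / 2 + 1) := Real.Gamma_pos_of_pos (by positivity)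
  rw [Measure.real, EuclideanSpace.volume_ball]
  simp only [ENNReal.ofReal_one, one_pow, one_mul, Fintype.card_fin]
  rw [ENNReal.toReal_ofReal (by positivity), unitBallVol, Real.sqrt_eq_rpow, ← Real.rpow_natCast,
    ← Real.rpow_mul Real.pi_pos.le]
  congr 2
  ring

lemma unitBallVol_pos (n : ℕ) : 0 < unitBallVol n := by
  have hg : 0 < Real.Gamma ((n : ℝ) / 2 + 1) := Real.Gamma_pos_of_pos (by positivity)
  unfold unitBallVol
  positivity

lemma setIntegral_morreyWeight_le {n : ℕ} (hn : 2 ≤ n) {p : ℝ} (hp : (n : ℝ) < p)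
    {K : Set (EuclideanSpace ℝ (Fin n))} (hK : MeasurableSet K) {r : ℝ} (hr0 : 0 < r) (hr1 : r < 1)
    (hKr : K ⊆ Metric.ball 0 r) (hV : 0 < ∫ x in K, (2 / (1 - ‖x‖ ^ 2)) ^ n) :
    ∫ x in K, morreyWeight n p (hypVol n ‖x‖) * (2 / (1 - ‖x‖ ^ 2)) ^ n
      ≤ n * unitBallVol n * ((p - 1) / (p - n) *
        ((∫ x in K, (2 / (1 - ‖x‖ ^ 2)) ^ n) / unitBallVol n) ^ ((p - n) / (n * (p - 1)))) := by
  have hnR : (2 : ℝ) ≤ n := by exact_mod_cast hn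
  have hσ := unitBallVol_pos n
  have : Nontrivial (EuclideanSpace ℝ (Fin n)) :=
    Module.nontrivial_of_finrank_pos (R := ℝ) (by simp; omega)
  obtain ⟨iH, eH⟩ := integral_ball_density (n := n) (by omega) hr0.le hr1
  rw [volume_real_ball_eq_unitBallVol (by omega)] at eH
  have hH0 {x : EuclideanSpace ℝ (Fin n)} (hx : x ∈ Metric.ball (0 : EuclideanSpace ℝ (Fin n)) r) :
      0 ≤ (2 / (1 - ‖x‖ ^ 2)) ^ n := by
    have := one_sub_norm_sq_pos hr1.le hx
    positivity
  have hVle : ∫ x in K, (2 / (1 - ‖x‖ ^ 2)) ^ n ≤ n * unitBallVol n * hypVol n r := by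
    rw [← eH]
    refine setIntegral_mono_set iH ?_ (Filter.Eventually.of_forall hKr)
    exact (ae_restrict_iff' Metric.isOpen_ball.measurableSet).mpr
      (Filter.Eventually.of_forall fun x hx => hH0 hx)
  generalize hVd : ∫ x in K, (2 / (1 - ‖x‖ ^ 2)) ^ n = V at *
  have hc : ContinuousOn (hypVol n) (Set.Icc 0 r) :=
    (continuousOn_hypVol n).mono fun x hx => ⟨hx.1, hx.2.trans_lt hr1⟩
  obtain ⟨R, hR, hRV⟩ : V / (n * unitBallVol n) ∈ hypVol n '' Set.Icc 0 r := by
    refine intermediate_value_Icc hr0.le hc ⟨?_, ?_⟩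
    · rw [hypVol_zero]; positivity
    · rw [div_le_iff₀ (by positivity)]; linarith
  have hR0 : 0 < R := by
    rcases hR.1.lt_or_eq with h | h
    · exact h
    · rw [← h, hypVol_zero] at hRV
      have : 0 < V / (n * unitBallVol n) := by positivity
      linarith
  have hR1 : R < 1 := hR.2.trans_lt hr1
  have hBr : Metric.ball (0 : EuclideanSpace ℝ (Fin n)) R ⊆ Metric.ball 0 r :=
    Metric.ball_subset_ball hR.2
  obtain ⟨iHR, eHR⟩ := integral_ball_density (n := n) (by omega) hR0.le hR1
  obtain ⟨iW, eW⟩ := integral_ball_morreyWeight hn hp hR0.le hR1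
  have iW' := (integral_ball_morreyWeight hn hp hr0.le hr1).1
  rw [volume_real_ball_eq_unitBallVol (by omega), hRV] at eHR eW
  have e1 : (n : ℝ) * (V / (n * unitBallVol n)) = V / unitBallVol n := by field_simp
  have e2 : n * unitBallVol n * (V / (n * unitBallVol n)) = V := by field_simp
  rw [e1] at eW
  rw [e2] at eHR
  rw [← eW]
  set B := Metric.ball (0 : EuclideanSpace ℝ (Fin n)) R with hB
  have hBm : MeasurableSet B := Metric.isOpen_ball.measurableSet
  set w : EuclideanSpace ℝ (Fin n) → ℝ :=
    fun x => morreyWeight n p (hypVol n ‖x‖) * (2 / (1 - ‖x‖ ^ 2)) ^ n with hw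
  set H : EuclideanSpace ℝ (Fin n) → ℝ := fun x => (2 / (1 - ‖x‖ ^ 2)) ^ n with hHd
  set ω := morreyWeight n p (hypVol n R) with hω
  have hanti {s t : ℝ} (hs : 0 < s) (hst : s ≤ t) : morreyWeight n p t ≤ morreyWeight n p s := by
    unfold morreyWeight
    refine Real.rpow_le_rpow_of_nonpos (by positivity) (by gcongr) ?_
    have : 0 < p - 1 := by linarith
    have : (0 : ℝ) < n - 1 := by linarith
    have : 0 < p := by linarith
    rw [neg_nonpos]
    positivity
  have hmono := (hypVol_strictMonoOn n).monotoneOn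
  have key : ∫ x in K, (w x - ω * H x) ≤ ∫ x in B, (w x - ω * H x) := by
    have i1 : IntegrableOn (fun x => w x - ω * H x) (Metric.ball 0 r) := iW'.sub (iH.const_mul _)
    rw [← integral_indicator hK, ← integral_indicator hBm]
    refine integral_mono_ae ((i1.mono_set hKr).integrable_indicator hK)
      ((i1.mono_set hBr).integrable_indicator hBm) ?_
    filter_upwards [compl_mem_ae_iff.mpr
      (measure_singleton (μ := (volume : Measure (EuclideanSpace ℝ (Fin n)))) 0)] with x hx0
    have hx0 : 0 < ‖x‖ := norm_pos_iff.mpr hx0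
    have hfac : w x - ω * H x = (morreyWeight n p (hypVol n ‖x‖) - ω) * H x := by
      simp only [hw, hHd]; ring
    by_cases hxK : x ∈ K <;> by_cases hxB : x ∈ B
    · simp [hxK, hxB]
    · rw [Set.indicator_of_mem hxK, Set.indicator_of_notMem hxB, hfac]
      have h1 : R ≤ ‖x‖ := by simpa [hB] using hxB
      have h2 : ‖x‖ < 1 := (mem_ball_zero_iff.mp (hKr hxK)).trans hr1
      exact mul_nonpos_of_nonpos_of_nonneg (sub_nonpos.mpr (hanti (hypVol_pos n hR0 hR1)
        (hmono ⟨hR0.le, hR1⟩ ⟨hx0.le, h2⟩ h1))) (hH0 (hKr hxK))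
    · rw [Set.indicator_of_mem hxB, Set.indicator_of_notMem hxK, hfac]
      have h1 : ‖x‖ < R := by simpa [hB] using hxB
      exact mul_nonneg (sub_nonneg.mpr (hanti (hypVol_pos n hx0 (h1.trans hR1))
        (hmono ⟨hx0.le, h1.trans hR1⟩ ⟨hR0.le, hR1⟩ h1.le))) (hH0 (hBr hxB))
    · simp [hxK, hxB]
  rw [integral_sub (iW'.mono_set hKr) ((iH.mono_set hKr).const_mul _),
    integral_sub iW (iHR.const_mul _), integral_const_mul, integral_const_mul, hVd, eHR] at key
  linarith

lemma rpow_le_morreyConst_mul {n : ℕ} (hn : 2 ≤ n) {p : ℝ} (hp : (n : ℝ) < p) {M V W I : ℝ}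
    (hM : 0 < M) (hV : 0 < V)
    (hW : W ≤ n * unitBallVol n *
      ((p - 1) / (p - n) * (V / unitBallVol n) ^ ((p - n) / (n * (p - 1)))))
    (hI : ∀ c : ℝ, 0 ≤ c →
      n * unitBallVol n * (p * c * M) ≤ I + (p - 1) * c ^ (p / (p - 1)) * W) :
    M ^ p ≤ morreyConst n p ^ p * V ^ ((p - n) / n) * I := by
  have hnR : (2 : ℝ) ≤ n := by exact_mod_cast hn
  have hσ := unitBallVol_pos n
  have hp1 : 0 < p - 1 := by linarith
  have hpn : 0 < p - n := by linarith
  have hp0 : 0 < p := by linarith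
  rw [morreyConst]
  generalize unitBallVol n = σ at *
  obtain ⟨q, hq⟩ : ∃ q, q = (p - 1) / (p - n) := ⟨_, rfl⟩
  have hq0 : 0 < q := by rw [hq]; positivity
  obtain ⟨A, hA⟩ : ∃ A, A = q * (V / σ) ^ ((p - n) / (n * (p - 1))) := ⟨_, rfl⟩
  have hA0 : 0 < A := by rw [hA]; positivity
  rw [← hq, ← hA] at hW
  rw [← hq]
  have h1 := hI ((M / A) ^ (p - 1)) (by positivity)
  rw [← Real.rpow_mul (by positivity), mul_div_cancel₀ _ hp1.ne'] at h1
  have h2 : (p - 1) * (M / A) ^ p * W ≤ (p - 1) * (M / A) ^ p * (n * σ * A) := by gcongr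
  have e1 : (M / A) ^ p = M ^ p / A ^ (p - 1) / A := by
    rw [Real.div_rpow hM.le hA0.le, div_div, ← Real.rpow_add_one hA0.ne']
    congr 2; ring
  have e2 : (M / A) ^ (p - 1) * M = M ^ p / A ^ (p - 1) := by
    rw [Real.div_rpow hM.le hA0.le, div_mul_eq_mul_div, ← Real.rpow_add_one hM.ne']
    congr 2; ring
  have e3 : n * σ * (M ^ p / A ^ (p - 1)) ≤ I := by
    have e4 : n * σ * (p * (M / A) ^ (p - 1) * M) = n * σ * p * (M ^ p / A ^ (p - 1)) := by
      rw [← e2]; ring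
    have e5 : (p - 1) * (M / A) ^ p * (n * σ * A) = (p - 1) * (n * σ) * (M ^ p / A ^ (p - 1)) := by
      rw [e1]; field_simp
    rw [e4] at h1
    rw [e5] at h2
    linarith
  have hb : ((n : ℝ) ^ (-(1 / p)) * σ ^ (-(1 / (n : ℝ))) * q ^ ((p - 1) / p)) ^ p
      * V ^ ((p - n) / n) = A ^ (p - 1) / (n * σ) := by
    rw [hA, Real.mul_rpow (by positivity) (by positivity),
      Real.mul_rpow (by positivity) (by positivity), Real.mul_rpow hq0.le (by positivity),
      ← Real.rpow_mul (by positivity), ← Real.rpow_mul hσ.le, ← Real.rpow_mul hq0.le,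
      ← Real.rpow_mul (by positivity), Real.div_rpow hV.le hσ.le]
    have f1 : -(1 / p) * p = -1 := by field_simp
    have f2 : (p - 1) / p * p = p - 1 := by field_simp
    have f3 : (p - n) / (n * (p - 1)) * (p - 1) = (p - n) / n := by field_simp
    have f4 : -(1 / (n : ℝ)) * p = -((p - n) / n) - 1 := by field_simp; ring
    rw [f1, f2, f3, f4, Real.rpow_sub_one hσ.ne', Real.rpow_neg hσ.le, Real.rpow_neg_one]
    field_simp
  rw [hb]
  have hAp : 0 < A ^ (p - 1) := by positivity
  have h6 := mul_le_mul_of_nonneg_left e3 (show 0 ≤ A ^ (p - 1) / (n * σ) by positivity)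
  refine le_trans (le_of_eq ?_) h6
  field_simp

/-- An involutive isometry of the Poincaré ball, with its conformal factor and the rotation part of
its derivative. -/
structure PoincareInvolution (E : Type*) [NormedAddCommGroup E] [InnerProductSpace ℝ E] where
  /-- The underlying map. -/
  toFun : E → E
  /-- The conformal factor. -/
  factor : E → ℝ
  /-- The orthogonal part of the derivative. -/
  rot : E → E ≃ₗᵢ[ℝ] E
  involutive : Function.Involutive toFun
  mem_ball_iff : ∀ x, toFun x ∈ Metric.ball (0 : E) 1 ↔ x ∈ Metric.ball (0 : E) 1
  factor_pos : ∀ x ∈ Metric.ball (0 : E) 1, 0 < factor x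
  contDiffAt : ∀ x ∈ Metric.ball (0 : E) 1, ContDiffAt ℝ 1 toFun x
  hasFDerivAt : ∀ x ∈ Metric.ball (0 : E) 1,
    HasFDerivAt toFun (factor x • (rot x : E →L[ℝ] E)) x
  one_sub_norm_sq : ∀ x ∈ Metric.ball (0 : E) 1,
    1 - ‖toFun x‖ ^ 2 = factor x * (1 - ‖x‖ ^ 2)

lemma exists_poincareInvolution {E : Type*} [NormedAddCommGroup E] [InnerProductSpace ℝ E]
    {x₀ : E} (hx₀ : x₀ ∈ Metric.ball (0 : E) 1) :
    ∃ φ : PoincareInvolution E, φ.toFun 0 = x₀ := by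
  by_cases h0 : x₀ = 0
  · refine ⟨⟨id, fun _ => 1, fun _ => LinearIsometryEquiv.refl ℝ E, fun _ => rfl, fun _ => Iff.rfl,
      fun _ _ => one_pos, fun _ _ => contDiffAt_id, fun x _ => ?_, fun x _ => by simp⟩, h0.symm⟩
    rw [one_smul]
    exact hasFDerivAt_id x
  have hn0 : 0 < ‖x₀‖ := norm_pos_iff.mpr h0
  have hn1 : ‖x₀‖ < 1 := mem_ball_zero_iff.mp hx₀
  obtain ⟨c, hc⟩ : ∃ c, c = (‖x₀‖ ^ 2)⁻¹ • x₀ := ⟨_, rfl⟩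
  have hcn : ‖c‖ = ‖x₀‖⁻¹ := by
    rw [hc, norm_smul, norm_inv, norm_pow, norm_norm]
    field_simp
  have hc1 : 1 < ‖c‖ := by
    rw [hcn]
    exact (one_lt_inv₀ hn0).mpr hn1
  have hR2 : 0 < ‖c‖ ^ 2 - 1 := by nlinarith
  obtain ⟨R, hRd⟩ : ∃ R, R = √(‖c‖ ^ 2 - 1) := ⟨_, rfl⟩
  have hR0 : 0 < R := by rw [hRd]; exact Real.sqrt_pos.mpr hR2
  have hRsq : R ^ 2 = ‖c‖ ^ 2 - 1 := by rw [hRd]; exact Real.sq_sqrt hR2.le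
  have hne {x : E} (hx : x ∈ Metric.ball (0 : E) 1) : x ≠ c := by
    rintro rfl
    have := mem_ball_zero_iff.mp hx
    linarith
  have hfac {x : E} (hx : x ≠ c) : 0 < (R / dist x c) ^ 2 := by
    have := dist_pos.mpr hx
    positivity
  have hconf {x : E} (hx : x ≠ c) :
      1 - ‖EuclideanGeometry.inversion c R x‖ ^ 2 = (R / dist x c) ^ 2 * (1 - ‖x‖ ^ 2) := by
    have hd : 0 < dist x c := dist_pos.mpr hx
    rw [EuclideanGeometry.inversion, vsub_eq_sub, vadd_eq_add, norm_add_sq_real, norm_smul,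
      Real.norm_of_nonneg (by positivity), inner_smul_left, inner_sub_left, mul_pow,
      ← dist_eq_norm x c, real_inner_self_eq_norm_sq]
    have e1 : dist x c ^ 2 = ‖x‖ ^ 2 - 2 * inner ℝ x c + ‖c‖ ^ 2 := by
      rw [dist_eq_norm, norm_sub_sq_real]
    have e2 : (R / dist x c) ^ 2 * dist x c ^ 2 = ‖c‖ ^ 2 - 1 := by
      rw [← hRsq]; field_simp
    generalize (R / dist x c) ^ 2 = t at *
    simp only [conj_trivial]
    rw [e1] at e2 ⊢
    linear_combination (1 - t) * e2
  refine ⟨⟨EuclideanGeometry.inversion c R, fun x => (R / dist x c) ^ 2,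
    fun x => (ℝ ∙ (x - c))ᗮ.reflection, EuclideanGeometry.inversion_involutive c hR0.ne', ?_,
    fun x hx => hfac (hne hx), fun x hx => ?_,
    fun x hx => EuclideanGeometry.hasFDerivAt_inversion (hne hx), fun x hx => hconf (hne hx)⟩, ?_⟩
  · intro x
    by_cases hx : x = c
    · simp [hx]
    have h1 := hconf hx
    have h2 := hfac hx
    rw [mem_ball_zero_iff, mem_ball_zero_iff, ← sq_lt_one_iff₀ (norm_nonneg _),
      ← sq_lt_one_iff₀ (norm_nonneg _), ← sub_pos, h1, mul_pos_iff_of_pos_left h2, sub_pos]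
  · exact contDiffAt_const.inversion (n := 1) contDiffAt_const contDiffAt_id (hne hx)
  · change EuclideanGeometry.inversion c R 0 = x₀
    have hdist : dist 0 c = ‖c‖ := by rw [dist_comm, dist_zero_right]
    rw [EuclideanGeometry.inversion, hdist, div_pow, hRsq, hcn, vsub_eq_sub, vadd_eq_add, zero_sub,
      smul_neg, hc, smul_smul, ← sub_eq_neg_add, ← sub_smul]
    have : (‖x₀‖ ^ 2)⁻¹ - (‖x₀‖⁻¹ ^ 2 - 1) / ‖x₀‖⁻¹ ^ 2 * (‖x₀‖ ^ 2)⁻¹ = 1 := by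
      field_simp
      ring
    rw [this, one_smul]

namespace PoincareInvolution

variable {n : ℕ} (φ : PoincareInvolution (EuclideanSpace ℝ (Fin n)))

lemma setIntegral_image {K : Set (EuclideanSpace ℝ (Fin n))} (hK : MeasurableSet K)
    (hKb : K ⊆ Metric.ball 0 1) (f : EuclideanSpace ℝ (Fin n) → ℝ) :
    ∫ x in φ.toFun '' K, f x * (2 / (1 - ‖x‖ ^ 2)) ^ n
      = ∫ x in K, f (φ.toFun x) * (2 / (1 - ‖x‖ ^ 2)) ^ n := by
  rw [integral_image_eq_integral_abs_det_fderiv_smul volume hK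
    (fun x hx => (φ.hasFDerivAt x (hKb hx)).hasFDerivWithinAt) φ.involutive.injective.injOn]
  refine setIntegral_congr_fun hK fun x hx => ?_
  have hl := φ.factor_pos x (hKb hx)
  have hpos := one_sub_norm_sq_pos le_rfl (hKb hx)
  have hdet : |(φ.factor x • (φ.rot x : EuclideanSpace ℝ (Fin n) →L[ℝ]
      EuclideanSpace ℝ (Fin n))).det| = φ.factor x ^ n := by
    have h1 : |((φ.rot x : EuclideanSpace ℝ (Fin n) →L[ℝ] EuclideanSpace ℝ (Fin n)) :
        EuclideanSpace ℝ (Fin n) →ₗ[ℝ] EuclideanSpace ℝ (Fin n)).det| = 1 := by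
      rw [← Real.norm_eq_abs, ← LinearMap.normDet_eq_norm_det]
      exact (φ.rot x).toLinearIsometry.normDet_eq_one
    rw [ContinuousLinearMap.det, ContinuousLinearMap.toLinearMap_smul, LinearMap.det_smul, abs_mul, h1,
      finrank_euclideanSpace_fin, mul_one, abs_of_pos (by positivity)]
  simp only [smul_eq_mul]
  rw [hdet, φ.one_sub_norm_sq x (hKb hx)]
  simp only [div_pow, mul_pow]
  field_simp

lemma contDiff_comp {u : EuclideanSpace ℝ (Fin n) → ℝ} (hu : ContDiff ℝ 1 u)
    {K : Set (EuclideanSpace ℝ (Fin n))} (hK : IsClosed K) (hKb : K ⊆ Metric.ball 0 1)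
    (hvK : ∀ x ∉ K, u (φ.toFun x) = 0) : ContDiff ℝ 1 (u ∘ φ.toFun) := by
  rw [contDiff_iff_contDiffAt]
  intro x
  by_cases hx : x ∈ K
  · exact hu.contDiffAt.comp x (φ.contDiffAt x (hKb hx))
  · have : (u ∘ φ.toFun) =ᶠ[nhds x] fun _ => 0 := by
      filter_upwards [hK.isOpen_compl.mem_nhds hx] with y hy using hvK y hy
    exact contDiffAt_const.congr_of_eventuallyEq this

lemma norm_fderiv_comp {u : EuclideanSpace ℝ (Fin n) → ℝ} (hu : ContDiff ℝ 1 u)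
    {x : EuclideanSpace ℝ (Fin n)} (hx : x ∈ Metric.ball (0 : EuclideanSpace ℝ (Fin n)) 1) :
    ‖fderiv ℝ (u ∘ φ.toFun) x‖ = φ.factor x * ‖fderiv ℝ u (φ.toFun x)‖ := by
  have h := ((hu.differentiable one_ne_zero _).hasFDerivAt).comp x (φ.hasFDerivAt x hx)
  rw [h.fderiv, ContinuousLinearMap.comp_smul, norm_smul,
    ContinuousLinearMap.opNorm_comp_linearIsometryEquiv, Real.norm_of_nonneg (φ.factor_pos x hx).le]

end PoincareInvolution

lemma setIntegral_density_pos {n : ℕ} {v : EuclideanSpace ℝ (Fin n) → ℝ} (hv : Continuous v)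
    {K : Set (EuclideanSpace ℝ (Fin n))} (hK : IsCompact K) (hKb : K ⊆ Metric.ball 0 1)
    (hvK : ∀ x ∉ K, v x = 0) {x₀ : EuclideanSpace ℝ (Fin n)} (hx₀ : v x₀ ≠ 0) :
    0 < ∫ x in K, (2 / (1 - ‖x‖ ^ 2)) ^ n := by
  have hpos : ∀ x ∈ K, 0 < (2 / (1 - ‖x‖ ^ 2)) ^ n := fun x hx => by
    have := one_sub_norm_sq_pos le_rfl (hKb hx)
    positivity
  rw [setIntegral_pos_iff_support_of_nonneg_ae
    ((ae_restrict_iff' hK.measurableSet).mpr (Filter.Eventually.of_forall fun x hx => (hpos x hx).le))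
    ((continuousOn_density n le_rfl hKb).integrableOn_compact hK)]
  have hopen : IsOpen {x | v x ≠ 0} := isOpen_ne_fun hv continuous_const
  refine (hopen.measure_pos volume ⟨x₀, hx₀⟩).trans_le (measure_mono fun x hx => ?_)
  have hxK : x ∈ K := by
    by_contra h
    exact hx (hvK x h)
  exact ⟨(hpos x hxK).ne', hxK⟩

lemma abs_zero_rpow_le_morreyConst_mul {n : ℕ} (hn : 2 ≤ n) {p : ℝ} (hp : (n : ℝ) < p)
    {v : EuclideanSpace ℝ (Fin n) → ℝ} (hv : ContDiff ℝ 1 v) {K : Set (EuclideanSpace ℝ (Fin n))}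
    (hK : IsCompact K) (hKb : K ⊆ Metric.ball 0 1) (hvK : ∀ x ∉ K, v x = 0) :
    |v 0| ^ p ≤ morreyConst n p ^ p * (∫ x in K, (2 / (1 - ‖x‖ ^ 2)) ^ n) ^ ((p - n) / n) *
      ((∫ x in K, ((1 - ‖x‖ ^ 2) / 2) ^ p * ‖fderiv ℝ v x‖ ^ p * (2 / (1 - ‖x‖ ^ 2)) ^ n)
        - ((n - 1) / p) ^ p * (∫ x in K, |v x| ^ p * (2 / (1 - ‖x‖ ^ 2)) ^ n)) := by
  have hnR : (2 : ℝ) ≤ n := by exact_mod_cast hn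
  have hp0 : p ≠ 0 := by linarith
  have hp1 : p - 1 ≠ 0 := by linarith
  obtain ⟨r, ⟨hr0, hr1⟩, hKr⟩ := exists_pos_lt_subset_ball one_pos hK.isClosed hKb
  have hball := volume_real_ball_eq_unitBallVol (n := n) (by omega)
  have hI : ∀ c : ℝ, 0 ≤ c → n * unitBallVol n * (p * c * |v 0|) ≤
      (∫ x in K, ((1 - ‖x‖ ^ 2) / 2) ^ p * ‖fderiv ℝ v x‖ ^ p * (2 / (1 - ‖x‖ ^ 2)) ^ n)
        - ((n - 1) / p) ^ p * (∫ x in K, |v x| ^ p * (2 / (1 - ‖x‖ ^ 2)) ^ n)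
        + (p - 1) * c ^ (p / (p - 1)) *
          ∫ x in K, morreyWeight n p (hypVol n ‖x‖) * (2 / (1 - ‖x‖ ^ 2)) ^ n := by
    intro c hc
    rw [← hball]
    rcases abs_choice (v 0) with h | h
    · rw [h]
      exact energy_sub_mass_ge hn hp hc hv hK hr0 hr1 hKr hvK
    · rw [h]
      have := energy_sub_mass_ge hn hp hc hv.neg hK hr0 hr1 hKr fun x hx => by simp [hvK x hx]
      simpa only [fderiv_fun_neg, norm_neg, abs_neg, Pi.neg_apply] using this
  have h0 : 0 ≤ (∫ x in K, ((1 - ‖x‖ ^ 2) / 2) ^ p * ‖fderiv ℝ v x‖ ^ p * (2 / (1 - ‖x‖ ^ 2)) ^ n)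
        - ((n - 1) / p) ^ p * (∫ x in K, |v x| ^ p * (2 / (1 - ‖x‖ ^ 2)) ^ n) := by
    simpa [Real.zero_rpow (div_ne_zero hp0 hp1)] using hI 0 le_rfl
  rcases eq_or_ne (v 0) 0 with hv0 | hv0
  · rw [hv0, abs_zero, Real.zero_rpow hp0]
    have hb : 0 ≤ morreyConst n p := by
      have := unitBallVol_pos n
      have : 0 ≤ (p - 1) / (p - n) := div_nonneg (by linarith) (by linarith)
      unfold morreyConst
      positivity
    have hV : 0 ≤ ∫ x in K, (2 / (1 - ‖x‖ ^ 2)) ^ n :=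
      setIntegral_nonneg hK.measurableSet fun x hx => by
        have := one_sub_norm_sq_pos le_rfl (hKb hx)
        positivity
    positivity
  · have hV := setIntegral_density_pos hv.continuous hK hKb hvK hv0
    exact rpow_le_morreyConst_mul hn hp (abs_pos.mpr hv0) hV
      (setIntegral_morreyWeight_le hn hp hK.measurableSet hr0 hr1 hKr hV) hI

lemma abs_rpow_le_morreyConst_mul_of_mem_ball {n : ℕ} (hn : 2 ≤ n) {p : ℝ} (hp : (n : ℝ) < p)
    {u : EuclideanSpace ℝ (Fin n) → ℝ} (hu : ContDiff ℝ 1 u) {K : Set (EuclideanSpace ℝ (Fin n))}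
    (hK : IsCompact K) (hKb : K ⊆ Metric.ball 0 1) (huK : ∀ x ∉ K, u x = 0)
    {x₀ : EuclideanSpace ℝ (Fin n)} (hx₀ : x₀ ∈ Metric.ball (0 : EuclideanSpace ℝ (Fin n)) 1) :
    |u x₀| ^ p ≤ morreyConst n p ^ p * (∫ x in K, (2 / (1 - ‖x‖ ^ 2)) ^ n) ^ ((p - n) / n) *
      ((∫ x in K, ((1 - ‖x‖ ^ 2) / 2) ^ p * ‖fderiv ℝ u x‖ ^ p * (2 / (1 - ‖x‖ ^ 2)) ^ n)
        - ((n - 1) / p) ^ p * (∫ x in K, |u x| ^ p * (2 / (1 - ‖x‖ ^ 2)) ^ n)) := by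
  obtain ⟨φ, rfl⟩ := exists_poincareInvolution hx₀
  obtain ⟨L, hL⟩ : ∃ L, L = φ.toFun '' K := ⟨_, rfl⟩
  have hLc : IsCompact L := by
    rw [hL]
    exact hK.image_of_continuousOn fun x hx =>
      (φ.contDiffAt x (hKb hx)).continuousAt.continuousWithinAt
  have hLb : L ⊆ Metric.ball 0 1 := by
    rw [hL]
    rintro _ ⟨x, hx, rfl⟩
    exact (φ.mem_ball_iff x).mpr (hKb hx)
  have hKL : K = φ.toFun '' L := by
    rw [hL, ← Set.image_comp, φ.involutive.comp_self, Set.image_id]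
  have huL : ∀ x ∉ L, u (φ.toFun x) = 0 := fun x hx => huK _ fun h =>
    hx (hL ▸ ⟨_, h, φ.involutive x⟩)
  have e1 : ∫ x in K, ((1 - ‖x‖ ^ 2) / 2) ^ p * ‖fderiv ℝ u x‖ ^ p * (2 / (1 - ‖x‖ ^ 2)) ^ n
      = ∫ x in L, ((1 - ‖x‖ ^ 2) / 2) ^ p * ‖fderiv ℝ (u ∘ φ.toFun) x‖ ^ p *
        (2 / (1 - ‖x‖ ^ 2)) ^ n := by
    rw [hKL, φ.setIntegral_image hLc.measurableSet hLb
      fun x => ((1 - ‖x‖ ^ 2) / 2) ^ p * ‖fderiv ℝ u x‖ ^ p]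
    refine setIntegral_congr_fun hLc.measurableSet fun x hx => ?_
    have hf := φ.factor_pos x (hLb hx)
    have hd := one_sub_norm_sq_pos le_rfl (hLb hx)
    simp only [φ.norm_fderiv_comp hu (hLb hx), φ.one_sub_norm_sq x (hLb hx)]
    rw [← Real.mul_rpow (by positivity) (by positivity),
      ← Real.mul_rpow (by positivity) (by positivity)]
    ring_nf
  have e2 : ∫ x in K, |u x| ^ p * (2 / (1 - ‖x‖ ^ 2)) ^ n
      = ∫ x in L, |(u ∘ φ.toFun) x| ^ p * (2 / (1 - ‖x‖ ^ 2)) ^ n := by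
    rw [hKL, φ.setIntegral_image hLc.measurableSet hLb fun x => |u x| ^ p]
    rfl
  have e3 : ∫ x in K, (2 / (1 - ‖x‖ ^ 2)) ^ n = ∫ x in L, (2 / (1 - ‖x‖ ^ 2)) ^ n := by
    rw [hKL]
    simpa using φ.setIntegral_image hLc.measurableSet hLb fun _ => 1
  rw [e1, e2, e3]
  exact abs_zero_rpow_le_morreyConst_mul hn hp (φ.contDiff_comp hu hLc.isClosed hLb huL) hLc hLb huL

/-- The Poincaré–Morrey–Sobolev inequality in the Poincaré ball model of `ℍⁿ`. -/
theorem poincare_morrey_sobolev_hyperbolic (n : ℕ) (hn : 2 ≤ n) (p : ℝ) (hp : (n : ℝ) < p)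
    (u : EuclideanSpace ℝ (Fin n) → ℝ) (hu : ContDiff ℝ (⊤ : ℕ∞) u)
    (hsupp : tsupport u ⊆ Metric.ball (0 : EuclideanSpace ℝ (Fin n)) 1) :
    (⨆ x ∈ Metric.ball (0 : EuclideanSpace ℝ (Fin n)) 1, |u x|) ^ p
      ≤ morreyConst n p ^ p *
        (∫ x in tsupport u, (2 / (1 - ‖x‖ ^ 2)) ^ (n : ℝ)) ^ ((p - (n : ℝ)) / (n : ℝ)) *
        ((∫ x in Metric.ball (0 : EuclideanSpace ℝ (Fin n)) 1,
            ((1 - ‖x‖ ^ 2) / 2) ^ p * ‖fderiv ℝ u x‖ ^ p * (2 / (1 - ‖x‖ ^ 2)) ^ (n : ℝ))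
          - (((n : ℝ) - 1) / p) ^ p *
            ∫ x in Metric.ball (0 : EuclideanSpace ℝ (Fin n)) 1,
              |u x| ^ p * (2 / (1 - ‖x‖ ^ 2)) ^ (n : ℝ)) := by
  have hnR : (2 : ℝ) ≤ n := by exact_mod_cast hn
  have hp0 : 0 < p := by linarith
  have hu1 : ContDiff ℝ 1 u := hu.of_le (by exact_mod_cast le_top)
  have hK : IsCompact (tsupport u) :=
    Metric.isCompact_of_isClosed_isBounded (isClosed_tsupport u) (Metric.isBounded_ball.subset hsupp)
  have huK : ∀ x ∉ tsupport u, u x = 0 := fun x hx => image_eq_zero_of_notMem_tsupport hx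
  simp only [Real.rpow_natCast]
  have e1 : ∫ x in Metric.ball (0 : EuclideanSpace ℝ (Fin n)) 1,
        ((1 - ‖x‖ ^ 2) / 2) ^ p * ‖fderiv ℝ u x‖ ^ p * (2 / (1 - ‖x‖ ^ 2)) ^ n
      = ∫ x in tsupport u,
        ((1 - ‖x‖ ^ 2) / 2) ^ p * ‖fderiv ℝ u x‖ ^ p * (2 / (1 - ‖x‖ ^ 2)) ^ n :=
    setIntegral_eq_of_subset_of_forall_sdiff_eq_zero Metric.isOpen_ball.measurableSet hsupp
      fun x hx => by
        simp [fderiv_eq_zero_of_forall_notMem hK.isClosed huK hx.2, Real.zero_rpow hp0.ne']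
  have e2 : ∫ x in Metric.ball (0 : EuclideanSpace ℝ (Fin n)) 1,
        |u x| ^ p * (2 / (1 - ‖x‖ ^ 2)) ^ n
      = ∫ x in tsupport u, |u x| ^ p * (2 / (1 - ‖x‖ ^ 2)) ^ n :=
    setIntegral_eq_of_subset_of_forall_sdiff_eq_zero Metric.isOpen_ball.measurableSet hsupp
      fun x hx => by simp [huK x hx.2, Real.zero_rpow hp0.ne']
  rw [e1, e2]
  have key {x : EuclideanSpace ℝ (Fin n)} :=
    abs_rpow_le_morreyConst_mul_of_mem_ball hn hp hu1 hK hsupp huK (x₀ := x)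
  have h0 := (Real.rpow_nonneg (abs_nonneg (u 0)) p).trans (key (Metric.mem_ball_self one_pos))
  refine (Real.le_rpow_inv_iff_of_pos (Real.iSup_nonneg fun x => Real.iSup_nonneg fun _ =>
    abs_nonneg _) h0 hp0).mp ?_
  refine Real.iSup_le (fun x => Real.iSup_le (fun hx => ?_) ?_) ?_
  · exact (Real.le_rpow_inv_iff_of_pos (abs_nonneg _) h0 hp0).mpr (key hx)
  all_goals exact Real.rpow_nonneg h0 _
end

section
/- Let n ≥ 2 be an integer and define Φ : [0,∞) → [0,∞) by Φ(t) = n ∫₀ᵗ (sinh s)^{n−1} ds; Φ is a strictly increasing bijection of [0,∞) onto itself, and let Φ⁻¹ denote its inverse. Define k_{n,p}(s) = (sinh Φ⁻¹(s))^{p(n−1)} − s^{p(n−1)/n} for s ≥ 0. If either n = 2 and p ≥ 2, or n ≥ 3 and p ≥ 2n/(n−1), then k_{n,p}(s) ≥ ((n−1)/n)^p s^p for all s ≥ 0. -/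
open Real MeasureTheory

/-- A function with nonnegative derivative on `[0, ∞)` stays above its value at `0`. -/
lemma le_of_hasDerivAt_nonneg {f f' : ℝ → ℝ} (hf : ∀ x, 0 ≤ x → HasDerivAt f (f' x) x)
    (hf' : ∀ x, 0 ≤ x → 0 ≤ f' x) {t : ℝ} (ht : 0 ≤ t) : f 0 ≤ f t := by
  have hmono : MonotoneOn f (Set.Ici 0) := by
    refine monotoneOn_of_deriv_nonneg (convex_Ici 0)
      (fun x hx => (hf x hx).continuousAt.continuousWithinAt) ?_ ?_
    · intro x hx
      exact (hf x (interior_subset hx)).differentiableAt.differentiableWithinAt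
    · intro x hx
      rw [(hf x (interior_subset hx)).deriv]
      exact hf' x (interior_subset hx)
  exact hmono Set.self_mem_Ici ht ht

/-- The primitive of `sinh ^ m` vanishing at `0`. -/
noncomputable def sinhPowPrimitive (m : ℕ) (t : ℝ) : ℝ := ∫ s in (0 : ℝ)..t, sinh s ^ m

lemma sinhPowPrimitive_zero (m : ℕ) : sinhPowPrimitive m 0 = 0 := by
  simp [sinhPowPrimitive]

lemma hasDerivAt_sinhPowPrimitive (m : ℕ) (t : ℝ) :
    HasDerivAt (sinhPowPrimitive m) (sinh t ^ m) t :=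
  (continuous_sinh.pow m).integral_hasStrictDerivAt 0 t |>.hasDerivAt

lemma sinhPowPrimitive_nonneg (m : ℕ) {t : ℝ} (ht : 0 ≤ t) : 0 ≤ sinhPowPrimitive m t := by
  rw [← sinhPowPrimitive_zero m]
  exact le_of_hasDerivAt_nonneg (fun x _ => hasDerivAt_sinhPowPrimitive m x)
    (fun x hx => pow_nonneg (sinh_nonneg_iff.2 hx) m) ht

lemma pow_le_mul_sinhPowPrimitive (m : ℕ) {t : ℝ} (ht : 0 ≤ t) :
    t ^ (m + 1) ≤ (m + 1) * sinhPowPrimitive m t := by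
  have h := le_of_hasDerivAt_nonneg
    (f := fun x => (m + 1) * sinhPowPrimitive m x - x ^ (m + 1))
    (f' := fun x => (m + 1) * (sinh x ^ m - x ^ m)) (fun x _ => ?_) (fun x hx => ?_) ht
  · simp only [sinhPowPrimitive_zero] at h
    simp at h
    linarith
  · refine (((hasDerivAt_sinhPowPrimitive m x).const_mul ((m : ℝ) + 1)).sub
      (hasDerivAt_pow (m + 1) x)).congr_deriv ?_
    push_cast
    ring
  · have := pow_le_pow_left₀ hx (self_le_sinh_iff.2 hx) m
    exact mul_nonneg (by positivity) (by linarith)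

lemma exists_mul_sinhPowPrimitive_eq (m : ℕ) {s : ℝ} (hs : 0 ≤ s) :
    ∃ t, 0 ≤ t ∧ (m + 1) * sinhPowPrimitive m t = s := by
  have hcont : Continuous fun t => (m + 1) * sinhPowPrimitive m t :=
    continuous_const.mul (continuous_iff_continuousAt.2
      fun t => (hasDerivAt_sinhPowPrimitive m t).continuousAt)
  have hle : s ≤ (m + 1) * sinhPowPrimitive m (s + 1) := by
    have h1 := pow_le_mul_sinhPowPrimitive m (t := s + 1) (by linarith)
    have h2 := le_self_pow₀ (a := s + 1) (by linarith) (Nat.succ_ne_zero m)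
    rw [Nat.succ_eq_add_one] at h2
    linarith
  obtain ⟨t, ht, hts⟩ := intermediate_value_Icc (a := 0) (b := s + 1) (by linarith)
    hcont.continuousOn ⟨by simpa [sinhPowPrimitive_zero] using hs, hle⟩
  exact ⟨t, ht.1, hts⟩

lemma mul_sinhPowPrimitive_le_sinh_pow {m : ℕ} (hm : 0 < m) {t : ℝ} (ht : 0 ≤ t) :
    m * sinhPowPrimitive m t ≤ sinh t ^ m := by
  have h := le_of_hasDerivAt_nonneg
    (f := fun x => sinh x ^ m - m * sinhPowPrimitive m x)
    (f' := fun x => m * sinh x ^ (m - 1) * (cosh x - sinh x)) (fun x _ => ?_) (fun x hx => ?_) ht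
  · simp [sinhPowPrimitive_zero, hm.ne'] at h
    linarith
  · refine (((hasDerivAt_sinh x).pow m).sub
      ((hasDerivAt_sinhPowPrimitive m x).const_mul (m : ℝ))).congr_deriv ?_
    obtain ⟨k, rfl⟩ := Nat.exists_eq_succ_of_ne_zero hm.ne'
    simp only [Nat.succ_eq_add_one, Nat.add_sub_cancel]
    ring
  · have := sinh_nonneg_iff.2 hx
    have := sinh_lt_cosh x
    exact mul_nonneg (by positivity) (by linarith)

lemma hasDerivAt_mul_sinhPowPrimitive_rpow (m : ℕ) {a : ℝ} (ha : 1 ≤ a) (t : ℝ) :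
    HasDerivAt (fun x => (m * sinhPowPrimitive m x) ^ a)
      (m * sinh t ^ m * a * (m * sinhPowPrimitive m t) ^ (a - 1)) t :=
  ((hasDerivAt_sinhPowPrimitive m t).const_mul (m : ℝ)).rpow_const (Or.inr ha)

lemma sinhPowPrimitive_add_rpow_le_mul_cosh {m : ℕ} (hm : 0 < m) {t : ℝ} (ht : 0 ≤ t) :
    (m + 1) * sinhPowPrimitive m t + (m * sinhPowPrimitive m t) ^ ((m + 2 : ℝ) / m)
      ≤ sinh t ^ (m + 1) * cosh t := by
  have hm' : (0 : ℝ) < m := by exact_mod_cast hm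
  have ha : 1 ≤ (m + 2 : ℝ) / m := by rw [le_div_iff₀ hm']; linarith
  have h := le_of_hasDerivAt_nonneg
    (f := fun x => sinh x ^ (m + 1) * cosh x - ((m + 1) * sinhPowPrimitive m x
      + (m * sinhPowPrimitive m x) ^ ((m + 2 : ℝ) / m)))
    (f' := fun x => (m + 2) * sinh x ^ m *
      (sinh x ^ 2 - (m * sinhPowPrimitive m x) ^ ((m + 2 : ℝ) / m - 1)))
    (fun x _ => ?_) (fun x hx => ?_) ht
  · have h0 : (0 : ℝ) ^ ((m + 2 : ℝ) / m) = 0 := zero_rpow (by positivity)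
    simp only [sinhPowPrimitive_zero, mul_zero, h0, sinh_zero] at h
    simp at h
    linarith
  · refine ((((hasDerivAt_sinh x).pow (m + 1)).mul (hasDerivAt_cosh x)).sub
      (((hasDerivAt_sinhPowPrimitive m x).const_mul ((m : ℝ) + 1)).add
        (hasDerivAt_mul_sinhPowPrimitive_rpow m ha x))).congr_deriv ?_
    have e : (m : ℝ) * ((m + 2) / m) = m + 2 := by field_simp
    have c := cosh_sq x
    generalize (m * sinhPowPrimitive m x) ^ ((m + 2 : ℝ) / m - 1) = R
    simp only [Nat.add_sub_cancel, Pi.pow_apply]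
    push_cast
    linear_combination (m + 1) * sinh x ^ m * c - sinh x ^ m * R * e
  · have hu := sinh_nonneg_iff.2 hx
    have h1 := rpow_le_rpow (mul_nonneg hm'.le (sinhPowPrimitive_nonneg m hx))
      (mul_sinhPowPrimitive_le_sinh_pow hm hx) (sub_nonneg.2 ha)
    have h2 : (sinh x ^ m) ^ ((m + 2 : ℝ) / m - 1) = sinh x ^ 2 := by
      rw [← rpow_natCast, ← rpow_mul hu, ← rpow_natCast]
      congr 1
      push_cast
      field_simp
      ring
    rw [h2] at h1
    exact mul_nonneg (by positivity) (by linarith)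

lemma sq_sinhPowPrimitive_add_rpow_le {m : ℕ} (hm : 0 < m) {t : ℝ} (ht : 0 ≤ t) :
    ((m + 1) * sinhPowPrimitive m t) ^ 2
        + (m * sinhPowPrimitive m t) ^ (2 * (m + 1 : ℝ) / m) ≤ sinh t ^ (2 * (m + 1)) := by
  have hm' : (0 : ℝ) < m := by exact_mod_cast hm
  have ha : 1 ≤ 2 * (m + 1 : ℝ) / m := by rw [le_div_iff₀ hm']; linarith
  have h := le_of_hasDerivAt_nonneg
    (f := fun x => sinh x ^ (2 * (m + 1)) - (((m + 1) * sinhPowPrimitive m x) ^ 2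
      + (m * sinhPowPrimitive m x) ^ (2 * (m + 1 : ℝ) / m)))
    (f' := fun x => 2 * (m + 1) * sinh x ^ m * (sinh x ^ (m + 1) * cosh x -
      ((m + 1) * sinhPowPrimitive m x + (m * sinhPowPrimitive m x) ^ ((m + 2 : ℝ) / m))))
    (fun x _ => ?_) (fun x hx => ?_) ht
  · have h0 : (0 : ℝ) ^ (2 * (m + 1 : ℝ) / m) = 0 := zero_rpow (by positivity)
    simp only [sinhPowPrimitive_zero, mul_zero, h0, sinh_zero] at h
    simp at h
    linarith
  · refine (((hasDerivAt_sinh x).pow (2 * (m + 1))).sub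
      ((((hasDerivAt_sinhPowPrimitive m x).const_mul ((m : ℝ) + 1)).pow 2).add
        (hasDerivAt_mul_sinhPowPrimitive_rpow m ha x))).congr_deriv ?_
    have e : (m : ℝ) * (2 * (m + 1) / m) = 2 * (m + 1) := by field_simp
    have e' : 2 * (m + 1 : ℝ) / m - 1 = (m + 2) / m := by field_simp; ring
    rw [e']
    generalize (m * sinhPowPrimitive m x) ^ ((m + 2 : ℝ) / m) = R
    have e'' : 2 * (m + 1) - 1 = m + (m + 1) := by lia
    rw [e'']
    push_cast
    linear_combination -sinh x ^ m * R * e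
  · have hu := sinh_nonneg_iff.2 hx
    have := sinhPowPrimitive_add_rpow_le_mul_cosh hm hx
    exact mul_nonneg (by positivity) (by linarith)

lemma sinhPowPrimitive_one (t : ℝ) : sinhPowPrimitive 1 t = cosh t - 1 := by
  simp only [sinhPowPrimitive, pow_one]
  rw [intervalIntegral.integral_eq_sub_of_hasDerivAt (fun x _ => hasDerivAt_cosh x)
    (continuous_sinh.intervalIntegrable 0 t), cosh_zero]

theorem k_lower_bound (n : ℕ) (hn : 2 ≤ n) (p : ℝ)
    (hp : (n = 2 ∧ 2 ≤ p) ∨ (3 ≤ n ∧ 2 * (n : ℝ) / ((n : ℝ) - 1) ≤ p))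
    (Φ Φinv : ℝ → ℝ)
    (hΦ : ∀ t, Φ t = (n : ℝ) * ∫ s in (0:ℝ)..t, Real.sinh s ^ ((n : ℝ) - 1))
    (hinv : ∀ t, 0 ≤ t → Φinv (Φ t) = t)
    (hinv' : ∀ s, 0 ≤ s → Φ (Φinv s) = s)
    (s : ℝ) (hs : 0 ≤ s) :
    Real.sinh (Φinv s) ^ (p * ((n : ℝ) - 1)) - s ^ (p * ((n : ℝ) - 1) / (n : ℝ))
      ≥ (((n : ℝ) - 1) / (n : ℝ)) ^ p * s ^ p := by
  obtain ⟨m, rfl⟩ : ∃ m, n = m + 1 := ⟨n - 1, by lia⟩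
  have hm : 0 < m := by lia
  have hm' : (0 : ℝ) < m := by exact_mod_cast hm
  have hcast : ((m + 1 : ℕ) : ℝ) - 1 = m := by push_cast; ring
  have hΦ' : ∀ t, Φ t = (m + 1) * sinhPowPrimitive m t := by
    intro t
    rw [hΦ, hcast]
    simp only [rpow_natCast, sinhPowPrimitive]
    push_cast
    rfl
  obtain ⟨t, ht, hts⟩ := exists_mul_sinhPowPrimitive_eq m hs
  have hst : Φinv s = t := by rw [← hts, ← hΦ', hinv t ht]
  have hu := sinh_nonneg_iff.2 ht
  rw [hst, hcast, ge_iff_le, le_sub_iff_add_le, add_comm, ← mul_rpow (by positivity) hs]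
  push_cast
  rcases hp with ⟨h2, hp⟩ | ⟨_, hp⟩
  · obtain rfl : m = 1 := by lia
    rw [sinhPowPrimitive_one] at hts
    have key : sinh t ^ 2 = s + (s / 2) ^ 2 := by
      rw [sinh_sq, ← hts]
      push_cast
      ring
    have h := Real.add_rpow_le_rpow_add hs (sq_nonneg (s / 2)) (p := p / 2) (by linarith)
    rw [← key, ← rpow_natCast, ← rpow_natCast, ← rpow_mul hu, ← rpow_mul (by positivity)] at h
    convert h using 2
    · push_cast; ring_nf
    · push_cast; ring_nf
    · push_cast; ring_nf
  · have key := sq_sinhPowPrimitive_add_rpow_le hm ht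
    have hF : (m : ℝ) * sinhPowPrimitive m t = m / (m + 1) * s := by
      rw [← hts]
      field_simp
    rw [hts, hF] at key
    rw [hcast] at hp
    push_cast at hp
    have hr : 1 ≤ p * m / (2 * (m + 1)) := by
      rw [div_le_iff₀ hm'] at hp
      rw [le_div_iff₀ (by positivity)]
      linarith
    have hb : 0 ≤ m / (m + 1) * s := by positivity
    have h := (Real.add_rpow_le_rpow_add (sq_nonneg s) (rpow_nonneg hb _) hr).trans
      (rpow_le_rpow (by positivity) key (by linarith))
    have e1 : ((2 : ℕ) : ℝ) * (p * m / (2 * (m + 1))) = p * m / (m + 1) := by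
      push_cast
      field_simp
    have e2 : 2 * (m + 1 : ℝ) / m * (p * m / (2 * (m + 1))) = p := by field_simp
    have e3 : ((2 * (m + 1) : ℕ) : ℝ) * (p * m / (2 * (m + 1))) = p * m := by
      push_cast
      field_simp
    rwa [← rpow_natCast, ← rpow_natCast, ← rpow_mul hu, ← rpow_mul hs, ← rpow_mul hb,
      e1, e2, e3] at h
end

section
/- Let n ≥ 4 be an integer, let p be a real number with 1 ≤ p < 2n/(n−1), and define Φ(t) = n ∫₀ᵗ (sinh s)^{n−1} ds and F_{n,p}(t) = (sinh t)^{p(n−1)} − Φ(t)^{p(n−1)/n} − ((n−1)/n)^p Φ(t)^p. Then there exists t₀ > 0 such that F_{n,p}(t) < 0 for all t > t₀. (Equivalently, the pointwise bound k_{n,p}(s) ≥ ((n−1)/n)^p s^p fails for all large s, so the condition p ≥ 2n/(n−1) in the lower bound for k_{n,p} is sharp.) -/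
open Real MeasureTheory

theorem hasDerivAt_integral_sinh_pow (m : ℕ) (t : ℝ) :
    HasDerivAt (fun t => ∫ s in (0:ℝ)..t, sinh s ^ m) (sinh t ^ m) t :=
  have hc : Continuous fun s : ℝ => sinh s ^ m := Real.continuous_sinh.pow m
  intervalIntegral.integral_hasDerivAt_right (hc.intervalIntegrable _ _)
    hc.stronglyMeasurable.stronglyMeasurableAtFilter hc.continuousAt

/-- The primitive of `sinh ^ m` agrees with `sinh ^ m / m` up to an error of order
`sinh ^ (m - 2)`, here with `m = k + 3`. -/
theorem sinh_pow_sub_integral_le (k : ℕ) {t : ℝ} (ht : 0 ≤ t) :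
    sinh t ^ (k + 3) - ((k : ℝ) + 3) * ∫ s in (0:ℝ)..t, sinh s ^ (k + 3) ≤
      ((k : ℝ) + 3) / (2 * (k + 1)) * sinh t ^ (k + 1) := by
  set C : ℝ := ((k : ℝ) + 3) / (2 * (k + 1)) with hC
  have hk : (0 : ℝ) < k + 1 := by positivity
  have hCk : C * (k + 1) = (k + 3) / 2 := by rw [hC]; field_simp
  let G : ℝ → ℝ := fun t => C * sinh t ^ (k + 1) - sinh t ^ (k + 3) +
    ((k : ℝ) + 3) * ∫ s in (0:ℝ)..t, sinh s ^ (k + 3)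
  have hG : ∀ u, HasDerivAt G
      (((k : ℝ) + 3) * sinh u ^ k * (cosh u / 2 - sinh u ^ 2 * (cosh u - sinh u))) u := by
    intro u
    have h := (((((hasDerivAt_sinh u).pow (k + 1)).const_mul C).sub
      ((hasDerivAt_sinh u).pow (k + 3))).add
      ((hasDerivAt_integral_sinh_pow (k + 3) u).const_mul ((k : ℝ) + 3)))
    refine h.congr_deriv ?_
    simp only [Nat.add_sub_cancel, show k + 3 - 1 = k + 2 from rfl]
    push_cast
    linear_combination (sinh u ^ k * cosh u) * hCk
  have hmono : MonotoneOn G (Set.Ici 0) := by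
    refine monotoneOn_of_deriv_nonneg (convex_Ici 0)
      (fun u _ => (hG u).continuousAt.continuousWithinAt)
      (fun u _ => (hG u).differentiableAt.differentiableWithinAt) fun u hu => ?_
    rw [interior_Ici] at hu
    rw [(hG u).deriv]
    have hS : 0 ≤ sinh u := Real.sinh_nonneg_iff.2 (le_of_lt hu)
    have h1 : sinh u * (cosh u - sinh u) ≤ 1 / 2 := by
      nlinarith [sq_nonneg (cosh u - sinh u), Real.cosh_sq u]
    have h2 : 0 ≤ cosh u / 2 - sinh u ^ 2 * (cosh u - sinh u) := by
      nlinarith [mul_le_mul_of_nonneg_left h1 hS, Real.sinh_lt_cosh u]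
    positivity
  have h := hmono (Set.mem_Ici.2 le_rfl) (Set.mem_Ici.2 ht) ht
  simp only [G, Real.sinh_zero, intervalIntegral.integral_same] at h
  rw [zero_pow (by omega), zero_pow (by omega)] at h
  linarith

/-- Bernoulli's inequality in homogeneous form. -/
theorem rpow_sub_rpow_le {x y p : ℝ} (hx : 0 < x) (hy : 0 ≤ y) (hp : 1 ≤ p) :
    x ^ p - y ^ p ≤ p * x ^ (p - 1) * (x - y) := by
  have h := one_add_mul_self_le_rpow_one_add (s := y / x - 1)
    (by linarith [div_nonneg hy hx.le]) hp
  rw [add_sub_cancel, div_rpow hy hx.le, le_div_iff₀ (rpow_pos_of_pos hx p)] at h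
  have e : x ^ p = x ^ (p - 1) * x := by rw [rpow_sub_one hx.ne']; field_simp
  have e2 : (1 + p * (y / x - 1)) * x ^ p = x ^ p - p * x ^ (p - 1) * (x - y) := by
    rw [e]; field_simp; ring
  linarith

theorem tendsto_sinh_atTop : Filter.Tendsto sinh Filter.atTop Filter.atTop :=
  Filter.tendsto_atTop_mono' _
    ((Filter.eventually_ge_atTop 0).mono fun _ h => Real.self_le_sinh_iff.2 h) Filter.tendsto_id

/-- Sharpness of the condition `p ≥ 2n/(n-1)`: for `n ≥ 4` and `1 ≤ p < 2n/(n-1)`, the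
function `F_{n,p}(t) = (sinh t)^{p(n-1)} - Φ(t)^{p(n-1)/n} - ((n-1)/n)^p Φ(t)^p` is
eventually negative. -/
theorem F_eventually_negative (n : ℕ) (hn : 4 ≤ n) (p : ℝ)
    (hp1 : 1 ≤ p) (hp2 : p < 2 * (n : ℝ) / ((n : ℝ) - 1))
    (Φ F : ℝ → ℝ)
    (hΦ : ∀ t, Φ t = (n : ℝ) * ∫ s in (0:ℝ)..t, Real.sinh s ^ ((n : ℝ) - 1))
    (hF : ∀ t, F t = Real.sinh t ^ (p * ((n : ℝ) - 1)) - Φ t ^ (p * ((n : ℝ) - 1) / (n : ℝ))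
      - (((n : ℝ) - 1) / (n : ℝ)) ^ p * Φ t ^ p) :
    ∃ t₀ > (0:ℝ), ∀ t > t₀, F t < 0 := by
  obtain ⟨k, rfl⟩ := Nat.exists_eq_add_of_le' hn
  set C : ℝ := ((k : ℝ) + 3) / (2 * (k + 1)) with hC
  have hC0 : 0 < C := by positivity
  have hm : ((k + 4 : ℕ) : ℝ) - 1 = ((k + 3 : ℕ) : ℝ) := by push_cast; ring
  simp only [hm, rpow_natCast] at hΦ hF hp2
  set m : ℝ := ((k + 3 : ℕ) : ℝ) with hmdef
  have hm3 : m = k + 3 := by rw [hmdef]; push_cast; ring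
  have hn4 : ((k + 4 : ℕ) : ℝ) = m + 1 := by rw [hm3]; push_cast; ring
  simp only [hn4] at hΦ hF hp2
  have hm0 : 0 < m := by rw [hm3]; positivity
  set a : ℝ := p * m / (m + 1) with ha
  have ha0 : 0 < a := by positivity
  have hexp : 0 < m * a - (p * m - 2) := by
    rw [lt_div_iff₀ hm0] at hp2
    have : m * a - (p * m - 2) = (2 * (m + 1) - p * m) / (m + 1) := by
      rw [ha]; field_simp; ring
    rw [this]
    exact div_pos (by linarith) (by positivity)
  have hlim := (tendsto_rpow_atTop hexp).comp tendsto_sinh_atTop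
  obtain ⟨T, hT⟩ := Filter.eventually_atTop.1
    ((hlim.eventually_gt_atTop (p * C * 2 ^ a)).and
      (tendsto_sinh_atTop.eventually_ge_atTop (2 * C + 1)))
  refine ⟨max T 1, by positivity, fun t ht => ?_⟩
  obtain ⟨h1, h2⟩ := hT t ((le_max_left _ _).trans ht.le)
  have ht0 : 0 ≤ t := zero_le_one.trans ((le_max_right T 1).trans ht.le)
  have hD := sinh_pow_sub_integral_le k ht0
  rw [← hC, ← hm3] at hD
  simp only [Function.comp] at h1
  rw [hF, hΦ]
  set I := ∫ s in (0:ℝ)..t, sinh s ^ (k + 3)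
  set x := sinh t
  have hx1 : 1 ≤ x := by linarith
  have hx : 0 < x := by linarith
  have hhalf : x ^ (k + 3) / 2 ≤ m * I := by
    have : 2 * C * x ^ (k + 1) ≤ x ^ 2 * x ^ (k + 1) := by
      gcongr; nlinarith
    have e : x ^ (k + 3) = x ^ 2 * x ^ (k + 1) := by ring
    linarith
  have hpow : 0 < x ^ (k + 3) := by positivity
  have hI : 0 ≤ m * I := by linarith
  have hI0 : 0 ≤ I := nonneg_of_mul_nonneg_right hI hm0
  have hlast : (m / (m + 1)) ^ p * ((m + 1) * I) ^ p = (m * I) ^ p := by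
    rw [← mul_rpow (by positivity) (by positivity)]
    congr 1; field_simp
  have hxm : x ^ (k + 3) = x ^ m := (rpow_natCast x (k + 3)).symm
  have hB := rpow_sub_rpow_le hpow hI hp1
  have hB2 : (x ^ (k + 3)) ^ p - (m * I) ^ p ≤ p * C * x ^ (p * m - 2) := by
    refine (hB.trans (mul_le_mul_of_nonneg_left hD (by positivity))).trans_eq ?_
    rw [← rpow_natCast x (k + 1), hxm, ← rpow_mul hx.le]
    have : x ^ (p * m - 2) = x ^ (m * (p - 1)) * x ^ ((k + 1 : ℕ) : ℝ) := by
      rw [← rpow_add hx]; congr 1; push_cast; rw [hm3]; ring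
    rw [this]; ring
  have hmid : x ^ (m * a) / 2 ^ a ≤ ((m + 1) * I) ^ a := by
    rw [rpow_mul hx.le, ← hxm, ← div_rpow hpow.le (by norm_num)]
    exact rpow_le_rpow (by positivity) (by linarith) ha0.le
  have hfin : p * C * x ^ (p * m - 2) < x ^ (m * a) / 2 ^ a := by
    rw [lt_div_iff₀ (by positivity)]
    rw [rpow_sub hx, lt_div_iff₀ (by positivity)] at h1
    linarith
  have hfst : x ^ (p * m) = (x ^ (k + 3)) ^ p := by
    rw [hxm, ← rpow_mul hx.le, mul_comm]
  rw [hlast, hfst]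
  linarith
end

section
/- Let n = 3 and let p be a real number with 1 ≤ p < 3. Define Φ(t) = 3 ∫₀ᵗ (sinh s)² ds = (3/8)(e^{2t} − e^{−2t} − 4t) and F_{3,p}(t) = (sinh t)^{2p} − Φ(t)^{2p/3} − (2/3)^p Φ(t)^p. Then there exists t₀ > 0 such that F_{3,p}(t) < 0 for all t > t₀. -/
open Real MeasureTheory

/-- The tangent-line inequality for the convex function `x ↦ x ^ p`. -/
theorem rpow_sub_rpow_le_mul_rpow_sub_one {a b p : ℝ} (ha : 0 < a) (hb : 0 ≤ b) (hp : 1 ≤ p) :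
    a ^ p - b ^ p ≤ p * a ^ (p - 1) * (a - b) := by
  have hs : -1 ≤ b / a - 1 := by linarith [div_nonneg hb ha.le]
  have bernoulli := one_add_mul_self_le_rpow_one_add hs hp
  rw [add_sub_cancel, Real.div_rpow hb ha.le, le_div_iff₀ (Real.rpow_pos_of_pos ha p)] at bernoulli
  have hpow : a ^ p = a ^ (p - 1) * a := by
    rw [← Real.rpow_add_one ha.ne', sub_add_cancel]
  have expand : (1 + p * (b / a - 1)) * a ^ p = a ^ p - p * a ^ (p - 1) * (a - b) := by
    rw [hpow]
    field_simp
    ring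
  linarith

/-- An explicit threshold beyond which `exp (c * t)` dominates `3 * t`. -/
theorem three_mul_lt_exp_mul {c t : ℝ} (hc : 0 < c) (ht : 6 / c ^ 2 ≤ t) :
    3 * t < Real.exp (c * t) := by
  have ht0 : 0 < t := lt_of_lt_of_le (by positivity) ht
  have hct : 6 ≤ t * c ^ 2 := (div_le_iff₀ (by positivity)).mp ht
  have hquad := Real.quadratic_le_exp_of_nonneg (mul_pos hc ht0).le
  nlinarith [mul_le_mul_of_nonneg_left hct ht0.le, mul_pos hc ht0]

theorem exp_le_sinh_sq {t : ℝ} (ht : 5 ≤ t) : Real.exp t ≤ Real.sinh t ^ 2 := by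
  have hexp : 6 ≤ Real.exp t := by linarith [Real.add_one_le_exp t]
  have hinv : Real.exp t * Real.exp (-t) = 1 := by rw [← Real.exp_add]; simp
  rw [Real.sinh_eq]
  nlinarith [sq_nonneg (Real.exp (-t))]

/-- Sharpness in dimension `n = 3`: for `1 ≤ p < 3`, the function
`F_{3,p}(t) = (sinh t)^{2p} - Φ(t)^{2p/3} - (2/3)^p Φ(t)^p`, with
`Φ(t) = 3∫₀ᵗ (sinh s)² ds = (3/8)(e^{2t} - e^{-2t} - 4t)`, is eventually negative. -/
theorem F_eventually_negative_dim_three (p : ℝ) (hp1 : 1 ≤ p) (hp2 : p < 3)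
    (Φ F : ℝ → ℝ)
    (hΦ : ∀ t, Φ t = 3 * ∫ s in (0:ℝ)..t, Real.sinh s ^ 2)
    (hΦ' : ∀ t, Φ t = (3 / 8) * (Real.exp (2 * t) - Real.exp (-(2 * t)) - 4 * t))
    (hF : ∀ t, F t = Real.sinh t ^ (2 * p) - Φ t ^ (2 * p / 3) - (2 / 3) ^ p * Φ t ^ p) :
    ∃ t₀ > (0:ℝ), ∀ t > t₀, F t < 0 := by
  have hc : 0 < 1 - p / 3 := by linarith
  refine ⟨5 + 6 / (1 - p / 3) ^ 2, by positivity, fun t ht => ?_⟩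
  have ht5 : 5 ≤ t := by
    have : 0 ≤ 6 / (1 - p / 3) ^ 2 := by positivity
    linarith
  have htc : 6 / (1 - p / 3) ^ 2 ≤ t := by linarith
  have hexp : Real.exp t ≤ Real.sinh t ^ 2 := exp_le_sinh_sq ht5
  have hsinh : 0 ≤ Real.sinh t := Real.sinh_nonneg_iff.mpr (by linarith)
  have hquad := Real.quadratic_le_exp_of_nonneg (show (0 : ℝ) ≤ t by linarith)
  have hA3 : 3 * t ≤ Real.sinh t ^ 2 := by nlinarith
  have hpow : Real.sinh t ^ (2 * p) = (Real.sinh t ^ 2) ^ p := by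
    rw [Real.rpow_mul hsinh, Real.rpow_two]
  have hsq : Real.sinh t ^ 2 = (Real.exp (2 * t) + Real.exp (-(2 * t)) - 2) / 4 := by
    have hcosh := Real.cosh_two_mul t
    rw [Real.cosh_eq (2 * t)] at hcosh
    linarith [Real.cosh_sq t]
  have hdiff : Real.sinh t ^ 2 - 2 / 3 * Φ t ≤ t := by
    have : Real.exp (-(2 * t)) ≤ 1 := Real.exp_le_one_iff.mpr (by linarith)
    rw [hsq, hΦ']
    linarith
  rw [hF, hpow]
  generalize Real.sinh t ^ 2 = A at *
  have hA : 0 < A := by linarith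
  have hAΦ : A ≤ Φ t := by linarith
  have tangent := rpow_sub_rpow_le_mul_rpow_sub_one hA (b := 2 / 3 * Φ t) (by linarith) hp1
  rw [Real.mul_rpow (by norm_num) (by linarith)] at tangent
  have hgrow : 3 * t < A ^ (1 - p / 3) := by
    calc 3 * t < Real.exp ((1 - p / 3) * t) := three_mul_lt_exp_mul hc htc
      _ = Real.exp t ^ (1 - p / 3) := by rw [← Real.exp_mul, mul_comm]
      _ ≤ A ^ (1 - p / 3) := Real.rpow_le_rpow (Real.exp_pos t).le hexp hc.le
  have hApos : 0 < A ^ (p - 1) := Real.rpow_pos_of_pos hA _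
  have key : p * A ^ (p - 1) * (A - 2 / 3 * Φ t) < Φ t ^ (2 * p / 3) := by
    calc p * A ^ (p - 1) * (A - 2 / 3 * Φ t) ≤ p * A ^ (p - 1) * t :=
          mul_le_mul_of_nonneg_left hdiff (by positivity)
      _ ≤ A ^ (p - 1) * (3 * t) := by
          nlinarith [mul_pos hApos (show (0 : ℝ) < t by linarith)]
      _ < A ^ (p - 1) * A ^ (1 - p / 3) := mul_lt_mul_of_pos_left hgrow hApos
      _ = A ^ (2 * p / 3) := by rw [← Real.rpow_add hA]; congr 1; ring
      _ ≤ Φ t ^ (2 * p / 3) := Real.rpow_le_rpow hA.le hAΦ (by positivity)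
  linarith
end

section
/- Let p ≥ 2 be a real number and let a, b be real numbers with a − b ≤ 0 and b ≥ 0. Then |a − b|^p ≥ |a|^p + |b|^p − p·a·b^{p−1}. -/
open Real

/-- The first-order lower bound for `(b + t) ^ p`, with the extra term `t ^ p`. -/
theorem rpow_add_rpow_add_mul_le_add_rpow {p b t : ℝ} (hp : 2 ≤ p) (hb : 0 ≤ b) (ht : 0 ≤ t) :
    b ^ p + t ^ p + p * t * b ^ (p - 1) ≤ (b + t) ^ p := by
  have hd (x : ℝ) : HasDerivAt (fun x : ℝ => (b + x) ^ p - x ^ p - p * x * b ^ (p - 1))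
      (p * ((b + x) ^ (p - 1) - x ^ (p - 1) - b ^ (p - 1))) x := by
    have h := (((hasDerivAt_id' x).const_add b).rpow_const (p := p) (Or.inr (by linarith))).sub
      (hasDerivAt_rpow_const (x := x) (p := p) (Or.inr (by linarith))) |>.sub
      (((hasDerivAt_id' x).const_mul p).mul_const (b ^ (p - 1)))
    refine h.congr_deriv ?_
    ring
  have hm : MonotoneOn (fun x : ℝ => (b + x) ^ p - x ^ p - p * x * b ^ (p - 1)) (Set.Ici 0) := by
    refine monotoneOn_of_deriv_nonneg (convex_Ici 0)
      (fun x _ => (hd x).continuousAt.continuousWithinAt)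
      (fun x _ => (hd x).differentiableAt.differentiableWithinAt) fun x hx => ?_
    rw [interior_Ici, Set.mem_Ioi] at hx
    rw [(hd x).deriv]
    have := add_rpow_le_rpow_add hb hx.le (show 1 ≤ p - 1 by linarith)
    exact mul_nonneg (by linarith) (by linarith)
  have h := hm Set.self_mem_Ici (Set.mem_Ici.2 ht) ht
  simp only [add_zero, zero_rpow (show p ≠ 0 by linarith), mul_zero, zero_mul, sub_zero] at h
  linarith

/-- The first-order lower bound for `(b - t) ^ p`, with the extra term `t ^ p`. -/
theorem rpow_add_rpow_sub_mul_le_sub_rpow {p b t : ℝ} (hp : 2 ≤ p) (ht : 0 ≤ t) (htb : t ≤ b) :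
    b ^ p + t ^ p - p * t * b ^ (p - 1) ≤ (b - t) ^ p := by
  have hd (x : ℝ) : HasDerivAt (fun x : ℝ => (b - x) ^ p - x ^ p + p * x * b ^ (p - 1))
      (p * (b ^ (p - 1) - (b - x) ^ (p - 1) - x ^ (p - 1))) x := by
    have h := (((hasDerivAt_id' x).const_sub b).rpow_const (p := p) (Or.inr (by linarith))).sub
      (hasDerivAt_rpow_const (x := x) (p := p) (Or.inr (by linarith))) |>.add
      (((hasDerivAt_id' x).const_mul p).mul_const (b ^ (p - 1)))
    refine h.congr_deriv ?_
    ring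
  have hm : MonotoneOn (fun x : ℝ => (b - x) ^ p - x ^ p + p * x * b ^ (p - 1))
      (Set.Icc 0 b) := by
    refine monotoneOn_of_deriv_nonneg (convex_Icc 0 b)
      (fun x _ => (hd x).continuousAt.continuousWithinAt)
      (fun x _ => (hd x).differentiableAt.differentiableWithinAt) fun x hx => ?_
    rw [interior_Icc, Set.mem_Ioo] at hx
    rw [(hd x).deriv]
    have := add_rpow_le_rpow_add (sub_nonneg.2 hx.2.le) hx.1.le (show 1 ≤ p - 1 by linarith)
    rw [sub_add_cancel] at this
    exact mul_nonneg (by linarith) (by linarith)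
  have h := hm (Set.left_mem_Icc.2 (ht.trans htb)) ⟨ht, htb⟩ ht
  simp only [zero_rpow (show p ≠ 0 by linarith), mul_zero, zero_mul, sub_zero, add_zero] at h
  linarith

/-- Elementary inequality: for `p ≥ 2`, `a - b ≤ 0` and `b ≥ 0`,
`|a - b|^p ≥ |a|^p + |b|^p - p a b^{p-1}`. -/
theorem abs_sub_rpow_ge (p : ℝ) (hp : 2 ≤ p) (a b : ℝ) (hab : a - b ≤ 0) (hb : 0 ≤ b) :
    |a - b| ^ p ≥ |a| ^ p + |b| ^ p - p * a * b ^ (p - 1) := by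
  rw [abs_of_nonpos hab, abs_of_nonneg hb, neg_sub]
  rcases le_total 0 a with ha | ha
  · rw [abs_of_nonneg ha]
    linarith [rpow_add_rpow_sub_mul_le_sub_rpow hp ha (sub_nonpos.1 hab)]
  · rw [abs_of_nonpos ha]
    have h := rpow_add_rpow_add_mul_le_add_rpow hp hb (neg_nonneg.2 ha)
    rw [← sub_eq_add_neg] at h
    linarith
end

section
/- Let p ≥ 2 be a real number and let v : (0,∞) → [0,∞) be a nonincreasing continuously differentiable function such that v(s)^p · s → 0 as s → 0⁺ and as s → ∞ and such that ∫₀^∞ |v'(s)|^p s^p ds, ∫₀^∞ v(s)^p ds are finite. Then ∫₀^∞ |v'(s)|^p s^p ds ≥ ∫₀^∞ |(d/ds)(v(s) s^{1/p})|^p s^{p−1} ds + p^{−p} ∫₀^∞ v(s)^p ds. -/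
open Real MeasureTheory

/-- The tangent-line inequality for `t ↦ t ^ p` at `1`, with a remainder of power type. -/
lemma one_add_mul_sub_one_add_abs_rpow_le {p x : ℝ} (hp : 2 ≤ p) (hx : 0 ≤ x) :
    1 + p * (x - 1) + |x - 1| ^ p ≤ x ^ p := by
  have hp1 : 1 ≤ p - 1 := by linarith
  have bern : 1 + (p - 1) * (x - 1) ≤ x ^ (p - 1) := by
    simpa using one_add_mul_self_le_rpow_one_add (s := x - 1) (by linarith) hp1
  have split : ∀ y : ℝ, 0 ≤ y → y ^ p = y * y ^ (p - 1) := fun y hy => by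
    rw [← Real.rpow_one_add' hy (by linarith)]
    congr 1
    ring
  rcases le_total 1 x with h | h
  · have ht : 0 ≤ x - 1 := by linarith
    have hadd : 1 + (x - 1) ^ (p - 1) ≤ x ^ (p - 1) := by
      have := Real.add_rpow_le_rpow_add zero_le_one ht hp1
      rwa [Real.one_rpow, add_sub_cancel] at this
    rw [abs_of_nonneg ht, split x hx, split _ ht]
    nlinarith [mul_le_mul_of_nonneg_left hadd ht]
  · have ht : 0 ≤ 1 - x := by linarith
    have hsq : (1 - x) ^ p ≤ (1 - x) ^ 2 := by
      rw [← Real.rpow_two]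
      exact Real.rpow_le_rpow_of_exponent_ge' ht (by linarith) (by norm_num) hp
    rw [abs_sub_comm, abs_of_nonneg ht, split x hx]
    nlinarith [mul_le_mul_of_nonneg_left bern hx, mul_nonneg (sub_nonneg.2 hp) (sq_nonneg (1 - x))]

/-- The tangent-line inequality for `t ↦ t ^ p` at `a`, with a remainder of power type. -/
lemma rpow_add_mul_sub_add_abs_sub_rpow_le {p a b : ℝ} (hp : 2 ≤ p) (ha : 0 ≤ a) (hb : 0 ≤ b) :
    a ^ p + p * a ^ (p - 1) * (b - a) + |b - a| ^ p ≤ b ^ p := by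
  rcases ha.eq_or_lt with rfl | ha
  · simp [Real.zero_rpow (show p ≠ 0 by linarith), Real.zero_rpow (show p - 1 ≠ 0 by linarith),
      abs_of_nonneg hb]
  · obtain ⟨x, rfl⟩ : ∃ x, b = a * x := ⟨b / a, by field_simp⟩
    have hx : 0 ≤ x := nonneg_of_mul_nonneg_right hb ha
    have key := mul_le_mul_of_nonneg_left (one_add_mul_sub_one_add_abs_rpow_le hp hx)
      (Real.rpow_nonneg ha.le p)
    have hsplit : a ^ p = a ^ (p - 1) * a := by
      rw [← Real.rpow_add_one ha.ne', sub_add_cancel]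
    rw [show a * x - a = a * (x - 1) by ring, abs_mul, abs_of_pos ha,
      Real.mul_rpow ha.le (abs_nonneg _), Real.mul_rpow ha.le hx]
    refine le_of_eq_of_le ?_ key
    rw [mul_add, mul_add, hsplit]
    ring

/-- One-dimensional weighted Hardy-type inequality: for a nonincreasing nonnegative `C¹`
function `v` on `(0,∞)` with `v(s)^p s → 0` at `0⁺` and `∞`,
`∫₀^∞ |v'|^p s^p ds ≥ ∫₀^∞ |(v(s)s^{1/p})'|^p s^{p-1} ds + p^{-p} ∫₀^∞ v^p ds`. -/
theorem hardy_type_inequality (p : ℝ) (hp : 2 ≤ p) (v v' : ℝ → ℝ)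
    (hderiv : ∀ s ∈ Set.Ioi (0:ℝ), HasDerivAt v (v' s) s)
    (hcont : ContinuousOn v' (Set.Ioi 0))
    (hmono : AntitoneOn v (Set.Ioi 0))
    (hnonneg : ∀ s ∈ Set.Ioi (0:ℝ), 0 ≤ v s)
    (hlim0 : Filter.Tendsto (fun s => v s ^ p * s) (nhdsWithin 0 (Set.Ioi 0)) (nhds 0))
    (hlimtop : Filter.Tendsto (fun s => v s ^ p * s) Filter.atTop (nhds 0))
    (hint1 : IntegrableOn (fun s => |v' s| ^ p * s ^ p) (Set.Ioi 0))
    (hint2 : IntegrableOn (fun s => v s ^ p) (Set.Ioi 0)) :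
    ∫ s in Set.Ioi (0:ℝ), |v' s| ^ p * s ^ p
      ≥ (∫ s in Set.Ioi (0:ℝ),
          |v' s * s ^ (1 / p) + (1 / p) * v s * s ^ (1 / p - 1)| ^ p * s ^ (p - 1))
        + p ^ (-p) * ∫ s in Set.Ioi (0:ℝ), v s ^ p := by
  have hp0 : 0 < p := by linarith
  have hv : ContinuousOn v (Set.Ioi 0) := fun s hs => (hderiv s hs).continuousAt.continuousWithinAt
  have hv'neg : ∀ s ∈ Set.Ioi (0:ℝ), v' s ≤ 0 := fun s hs => by
    rw [← (hderiv s hs).hasDerivWithinAt.derivWithin (isOpen_Ioi.uniqueDiffWithinAt hs)]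
    exact hmono.derivWithin_nonpos
  have hIcross : IntegrableOn (fun s => v' s * p * v s ^ (p - 1) * s) (Set.Ioi 0) := by
    refine Integrable.mono' ((hint1.add hint2).const_mul p)
      (ContinuousOn.aestronglyMeasurable ?_ measurableSet_Ioi) ?_
    · exact ((hcont.mul continuousOn_const).mul
        (hv.rpow_const fun s _ => Or.inr (by linarith))).mul continuousOn_id
    · refine (ae_restrict_iff' measurableSet_Ioi).2 (Filter.Eventually.of_forall fun s hs => ?_)
      have hs0 : 0 < s := hs
      have hvs := hnonneg s hs
      have hw : 0 ≤ |v' s| * s := by positivity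
      have hpow : v s ^ (p - 1) * (|v' s| * s) ≤ (|v' s| * s) ^ p + v s ^ p := by
        have split : ∀ y : ℝ, 0 ≤ y → y ^ p = y ^ (p - 1) * y := fun y hy => by
          rw [← Real.rpow_add_one' hy (by linarith), sub_add_cancel]
        rcases le_total (|v' s| * s) (v s) with h | h
        · have := mul_le_mul_of_nonneg_left h (Real.rpow_nonneg hvs (p - 1))
          rw [← split _ hvs] at this
          linarith [Real.rpow_nonneg hw p]
        · have := mul_le_mul_of_nonneg_right
            (Real.rpow_le_rpow hvs h (by linarith : 0 ≤ p - 1)) hw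
          rw [← split _ hw] at this
          linarith [Real.rpow_nonneg hvs p]
      rw [Real.norm_eq_abs, abs_mul, abs_mul, abs_mul, abs_of_pos hp0, abs_of_pos hs0,
        abs_of_nonneg (Real.rpow_nonneg hvs _)]
      rw [Real.mul_rpow (abs_nonneg _) hs0.le] at hpow
      simp only [Pi.add_apply]
      nlinarith [mul_le_mul_of_nonneg_left hpow hp0.le]
  have hG : IntegrableOn (fun s => v' s * p * v s ^ (p - 1) * s + v s ^ p) (Set.Ioi 0) :=
    hIcross.add hint2
  have hG0 : ∫ s in Set.Ioi (0:ℝ), (v' s * p * v s ^ (p - 1) * s + v s ^ p) = 0 := by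
    simpa using integral_Ioi_deriv_mul_eq_sub (u := fun s => v s ^ p) (v := fun s => s)
      (u' := fun s => v' s * p * v s ^ (p - 1)) (v' := fun _ => 1)
      (fun s hs => (hderiv s hs).rpow_const (Or.inr (by linarith))) (fun s _ => hasDerivAt_id' s)
      (hG.congr_fun (fun s _ => by simp) measurableSet_Ioi) hlim0 hlimtop
  have hH : IntegrableOn (fun s => |v' s| ^ p * s ^ p - p ^ (-p) * v s ^ p) (Set.Ioi 0) :=
    hint1.sub (hint2.const_mul (p ^ (-p)))
  have hle : ∀ s ∈ Set.Ioi (0:ℝ),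
      |v' s * s ^ (1 / p) + (1 / p) * v s * s ^ (1 / p - 1)| ^ p * s ^ (p - 1) ≤
        |v' s| ^ p * s ^ p - p ^ (-p) * v s ^ p
          + p ^ (1 - p) * (v' s * p * v s ^ (p - 1) * s + v s ^ p) := fun s hs => by
    have hs0 : 0 < s := hs
    have hvs := hnonneg s hs
    have hw : 0 ≤ |v' s| * s := by positivity
    have key := rpow_add_mul_sub_add_abs_sub_rpow_le hp (div_nonneg hvs hp0.le) hw
    have hfactor : v' s * s ^ (1 / p) + (1 / p) * v s * s ^ (1 / p - 1)
        = s ^ (1 / p - 1) * (v s / p - |v' s| * s) := by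
      rw [abs_of_nonpos (hv'neg s hs)]
      have : s ^ (1 / p) = s ^ (1 / p - 1) * s := by
        rw [← Real.rpow_add_one hs0.ne', sub_add_cancel]
      rw [this]
      ring
    have hweight : |v' s * s ^ (1 / p) + (1 / p) * v s * s ^ (1 / p - 1)| ^ p * s ^ (p - 1)
        = |(|v' s| * s) - v s / p| ^ p := by
      rw [hfactor, abs_mul, abs_of_pos (Real.rpow_pos_of_pos hs0 _), abs_sub_comm,
        Real.mul_rpow (Real.rpow_nonneg hs0.le _) (abs_nonneg _), ← Real.rpow_mul hs0.le,
        mul_right_comm, ← Real.rpow_add hs0,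
        show (1 / p - 1) * p + (p - 1) = 0 by field_simp; ring, Real.rpow_zero, one_mul]
    have hsplit : v s ^ p = v s ^ (p - 1) * v s := by
      rw [← Real.rpow_add_one' hvs (by linarith), sub_add_cancel]
    have hpinv : p ^ (1 - p) = p * p ^ (-p) := by
      rw [← Real.rpow_one_add' hp0.le (by linarith), sub_eq_add_neg]
    have hdiv : (v s / p) ^ p = p ^ (-p) * v s ^ p := by
      rw [Real.div_rpow hvs hp0.le, Real.rpow_neg hp0.le]
      ring
    have hdiv' : (v s / p) ^ (p - 1) = p ^ (1 - p) * v s ^ (p - 1) := by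
      rw [Real.div_rpow hvs hp0.le, ← neg_sub p 1, Real.rpow_neg hp0.le]
      ring
    have hcross : p * (v s / p) ^ (p - 1) * (|v' s| * s - v s / p)
        = -(p ^ (1 - p) * (v' s * p * v s ^ (p - 1) * s + v s ^ p)) := by
      rw [hdiv', abs_of_nonpos (hv'neg s hs), hsplit]
      field_simp
      ring
    rw [hcross, hdiv, Real.mul_rpow (abs_nonneg _) hs0.le] at key
    rw [hweight]
    linarith
  have hmain := integral_mono_of_nonneg (μ := volume.restrict (Set.Ioi (0:ℝ)))
    ((ae_restrict_iff' measurableSet_Ioi).2 (Filter.Eventually.of_forall fun s hs =>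
      mul_nonneg (Real.rpow_nonneg (abs_nonneg _) p) (Real.rpow_nonneg (le_of_lt hs) _)))
    (hH.add (hG.const_mul (p ^ (1 - p))))
    ((ae_restrict_iff' measurableSet_Ioi).2 (Filter.Eventually.of_forall hle))
  have hsum : ∫ s in Set.Ioi (0:ℝ), (|v' s| ^ p * s ^ p - p ^ (-p) * v s ^ p
      + p ^ (1 - p) * (v' s * p * v s ^ (p - 1) * s + v s ^ p))
      = (∫ s in Set.Ioi (0:ℝ), |v' s| ^ p * s ^ p)
        - p ^ (-p) * ∫ s in Set.Ioi (0:ℝ), v s ^ p := by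
    rw [integral_add hH (hG.const_mul (p ^ (1 - p))),
      integral_sub hint1 (hint2.const_mul (p ^ (-p))), integral_const_mul, integral_const_mul, hG0,
      mul_zero, add_zero]
  have hbound := hmain.trans_eq hsum
  linarith
end
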